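/- Let p ∈ (0,1) and let (G_t)_{t≥1} be the preferential attachment process with edge-steps with parameter p, and set α = (1−p)/(2−p). Let 𝒯₂⁰(G_t) be the number of triples of vertex indices i < j < k with i·j·k ≥ t^{3α} such that each of the three pairs {i,j}, {i,k}, {j,k} is joined in G_t by at least one edge created at an edge-step. Then there exists a constant C > 0, depending only on p, such that for all t ≥ 2: E[𝒯₂⁰(G_t)] ≤ C · t^{3α} · (log t)⁸. -/

import Mathlib

open MeasureTheory Filter

attribute [local instance] Classical.propDecidable

/-- Degree of vertex `i` at time `t` computed from the endpoint process `ep`: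
the edge added at step `s` contributes `1` for each of its endpoints equal to `i`
(so a loop at `i` contributes `2`). -/
noncomputable def degOf {Ω : Type} (ep : ℕ → Ω → ℕ × ℕ) (t i : ℕ) (ω : Ω) : ℕ :=
  ∑ s ∈ Finset.Icc 1 t,
    ((if (ep s ω).1 = i then 1 else 0) + (if (ep s ω).2 = i then 1 else 0))

/-- The preferential attachment random graph process with edge-steps and parameter `p`.
`G_1` is a single vertex (labeled `1`) with a loop.  At each step `t + 1` (for `t ≥ 1`),
with probability `p` a vertex-step occurs: a new vertex `nv t + 1` is added together with an
edge to an old vertex `u`, chosen with probability `d_t(u) / (2t)`; with probability `1 - p`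
an edge-step occurs: an edge `{u, w}` is added, where `u` and `w` are chosen independently,
each with probability proportional to its degree.  The field `ep t` records the (ordered pair
of) endpoints of the unique edge added at step `t`, `nv t` is the number of vertices of `G_t`,
and `Z t` tells whether step `t` was a vertex-step.  The one-step conditional laws are
prescribed via conditional expectations with respect to a filtration `ℱ` to which the process
is adapted. -/
structure PAProcess (p : ℝ) where
  Ω : Type
  m0 : MeasurableSpace Ω
  μ : Measure Ω
  isProb : IsProbabilityMeasure μ
  ℱ : Filtration ℕ m0
  Z : ℕ → Ω → Bool
  nv : ℕ → Ω → ℕ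
  ep : ℕ → Ω → ℕ × ℕ
  nv_one : ∀ ω, nv 1 ω = 1
  ep_one : ∀ ω, ep 1 ω = (1, 1)
  nv_succ : ∀ t, 1 ≤ t → ∀ ω, nv (t + 1) ω = nv t ω + (if Z (t + 1) ω then 1 else 0)
  ep_vertexStep : ∀ t, 1 ≤ t → ∀ ω, Z (t + 1) ω = true →
    (ep (t + 1) ω).2 = nv t ω + 1 ∧ 1 ≤ (ep (t + 1) ω).1 ∧ (ep (t + 1) ω).1 ≤ nv t ω
  ep_edgeStep : ∀ t, 1 ≤ t → ∀ ω, Z (t + 1) ω = false →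
    1 ≤ (ep (t + 1) ω).1 ∧ (ep (t + 1) ω).1 ≤ nv t ω ∧
    1 ≤ (ep (t + 1) ω).2 ∧ (ep (t + 1) ω).2 ≤ nv t ω
  Z_meas : ∀ t, Measurable[ℱ t] (Z t)
  nv_meas : ∀ t, Measurable[ℱ t] (nv t)
  ep_meas : ∀ t, Measurable[ℱ t] (ep t)
  condLaw_Z : ∀ t, 1 ≤ t →
    μ[Set.indicator {ω | Z (t + 1) ω = true} (fun _ => (1 : ℝ)) | ℱ t] =ᵐ[μ] fun _ => p
  condLaw_vertex : ∀ t, 1 ≤ t → ∀ u,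
    μ[Set.indicator {ω | Z (t + 1) ω = true ∧ ep (t + 1) ω = (u, nv t ω + 1)}
        (fun _ => (1 : ℝ)) | ℱ t]
      =ᵐ[μ] fun ω => p * (degOf ep t u ω : ℝ) / (2 * t)
  condLaw_edge : ∀ t, 1 ≤ t → ∀ u w,
    μ[Set.indicator {ω | Z (t + 1) ω = false ∧ ep (t + 1) ω = (u, w)}
        (fun _ => (1 : ℝ)) | ℱ t]
      =ᵐ[μ] fun ω => (1 - p) * (degOf ep t u ω : ℝ) * (degOf ep t w ω : ℝ) / (2 * t) ^ 2

namespace PAProcess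

variable {p : ℝ} (P : PAProcess p)

/-- degree `d_t(i)` of vertex `i` in `G_t` (`0` if `i` is not yet present). -/
noncomputable def deg (t i : ℕ) (ω : P.Ω) : ℕ := degOf P.ep t i ω

/-- `i` and `j` are joined by at least one edge in `G_t`. -/
def Joined (t i j : ℕ) (ω : P.Ω) : Prop :=
  ∃ s ∈ Finset.Icc 1 t, P.ep s ω = (i, j) ∨ P.ep s ω = (j, i)

/-- number of triangles of `G_t`: sets of three distinct vertices pairwise joined by at
least one edge (counted without edge multiplicities). -/
noncomputable def triangles (t : ℕ) (ω : P.Ω) : ℕ :=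
  ((Finset.Icc 1 t ×ˢ Finset.Icc 1 t ×ˢ Finset.Icc 1 t).filter
    (fun q => q.1 < q.2.1 ∧ q.2.1 < q.2.2 ∧ P.Joined t q.1 q.2.1 ω ∧
      P.Joined t q.1 q.2.2 ω ∧ P.Joined t q.2.1 q.2.2 ω)).card

/-- number of cherries (paths of length 2) of `G_t`: unordered pairs of distinct edges of
`G_t` sharing a common endpoint.  The edges of `G_t` are indexed by their creation times
`1 ≤ s ≤ t`. -/
noncomputable def cherries (t : ℕ) (ω : P.Ω) : ℕ :=
  ((Finset.Icc 1 t ×ˢ Finset.Icc 1 t).filter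
    (fun q => q.1 < q.2 ∧
      ((P.ep q.1 ω).1 = (P.ep q.2 ω).1 ∨ (P.ep q.1 ω).1 = (P.ep q.2 ω).2 ∨
       (P.ep q.1 ω).2 = (P.ep q.2 ω).1 ∨ (P.ep q.1 ω).2 = (P.ep q.2 ω).2))).card

/-- global clustering coefficient of `G_t`. -/
noncomputable def clustering (t : ℕ) (ω : P.Ω) : ℝ :=
  3 * (P.triangles t ω : ℝ) / (P.cherries t ω : ℝ)

/-- clique number of `G_t`: the largest `k` such that `G_t` contains `k` distinct vertices
pairwise joined by at least one edge. -/
noncomputable def cliqueNum (t : ℕ) (ω : P.Ω) : ℕ :=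
  sSup {k | ∃ S : Finset ℕ, S ⊆ Finset.Icc 1 (P.nv t ω) ∧ S.card = k ∧
    ∀ i ∈ S, ∀ j ∈ S, i ≠ j → P.Joined t i j ω}

/-- `Γ_t(j)`: the number of distinct vertices joined to `j` by at least one edge in `G_t`. -/
noncomputable def nbrCount (t j : ℕ) (ω : P.Ω) : ℕ :=
  ((Finset.Icc 1 t).filter (fun i => P.Joined t i j ω)).card

/-- the time at which vertex `j` is added to the graph. -/
noncomputable def addTime (j : ℕ) (ω : P.Ω) : ℕ := sInf {t | P.nv t ω = j}

/-- at step `s` an edge joining `i` and `j` is added by an edge-step. -/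
def EdgeStepEdge (s i j : ℕ) (ω : P.Ω) : Prop :=
  2 ≤ s ∧ P.Z s ω = false ∧ (P.ep s ω = (i, j) ∨ P.ep s ω = (j, i))

/-- at step `s` an edge joining `i` and `j` is added by a vertex-step. -/
def VertexStepEdge (s i j : ℕ) (ω : P.Ω) : Prop :=
  2 ≤ s ∧ P.Z s ω = true ∧ (P.ep s ω = (i, j) ∨ P.ep s ω = (j, i))

/-- at step `s` vertex `j` is added by a vertex-step and its attaching edge connects it
to vertex `i`. -/
def AttachEdge (s i j : ℕ) (ω : P.Ω) : Prop :=
  2 ≤ s ∧ P.Z s ω = true ∧ P.ep s ω = (i, j) ∧ P.nv s ω = j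

/-- `i` and `j` are joined in `G_t` by at least one edge created at an edge-step. -/
def EdgeJoined (t i j : ℕ) (ω : P.Ω) : Prop :=
  ∃ s ∈ Finset.Icc 1 t, P.EdgeStepEdge s i j ω

/-- `i` and `j` are joined in `G_t` by at least one edge created at a vertex-step. -/
def VJoined (t i j : ℕ) (ω : P.Ω) : Prop :=
  ∃ s ∈ Finset.Icc 1 t, P.VertexStepEdge s i j ω

/-- `i` and `j` are joined in `G_t`, and exclusively by edges created at vertex-steps. -/
def OnlyVertexJoined (t i j : ℕ) (ω : P.Ω) : Prop :=
  P.Joined t i j ω ∧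
    ∀ s ∈ Finset.Icc 1 t, (P.ep s ω = (i, j) ∨ P.ep s ω = (j, i)) → P.Z s ω = true

end PAProcess

namespace PAProcess

section Bounds

attribute [local instance] PAProcess.m0 PAProcess.isProb

variable {p : ℝ} (P : PAProcess p)

/-- Bounded functions that are measurable with respect to the history up to time `s`. -/
def BddMeas (s : ℕ) (H : P.Ω → ℝ) : Prop :=
  StronglyMeasurable[P.ℱ s] H ∧ ∃ C, ∀ ω, |H ω| ≤ C

variable {P}

lemma BddMeas.mul {s : ℕ} {H G : P.Ω → ℝ} (hH : P.BddMeas s H) (hG : P.BddMeas s G) :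
    P.BddMeas s (fun ω => H ω * G ω) := by
  obtain ⟨h1, C, hC⟩ := hH
  obtain ⟨h2, D, hD⟩ := hG
  refine ⟨h1.mul h2, C * D, fun ω => ?_⟩
  rw [abs_mul]
  exact mul_le_mul (hC ω) (hD ω) (abs_nonneg _) ((abs_nonneg _).trans (hC ω))

lemma BddMeas.integrable {s : ℕ} {H : P.Ω → ℝ} (hH : P.BddMeas s H) : Integrable H P.μ := by
  obtain ⟨h1, C, hC⟩ := hH
  exact Integrable.of_bound (h1.mono (P.ℱ.le s)).aestronglyMeasurable C (.of_forall hC)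

lemma BddMeas.mono {s s' : ℕ} (h : s ≤ s') {H : P.Ω → ℝ} (hH : P.BddMeas s H) :
    P.BddMeas s' H :=
  ⟨hH.1.mono (P.ℱ.mono h), hH.2⟩

lemma bddMeas_const (s : ℕ) (c : ℝ) : P.BddMeas s (fun _ => c) :=
  ⟨stronglyMeasurable_const, |c|, fun _ => le_rfl⟩

lemma BddMeas.add {s : ℕ} {H G : P.Ω → ℝ} (hH : P.BddMeas s H) (hG : P.BddMeas s G) :
    P.BddMeas s (fun ω => H ω + G ω) := by
  obtain ⟨h1, C, hC⟩ := hH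
  obtain ⟨h2, D, hD⟩ := hG
  exact ⟨h1.add h2, C + D, fun ω => (abs_add_le _ _).trans (add_le_add (hC ω) (hD ω))⟩

lemma BddMeas.prod {ι : Type*} {s : ℕ} {S : Finset ι} {F : ι → P.Ω → ℝ}
    (h : ∀ i ∈ S, P.BddMeas s (F i)) : P.BddMeas s (fun ω => ∏ i ∈ S, F i ω) := by
  induction S using Finset.induction_on with
  | empty => simpa using bddMeas_const s 1
  | insert a S ha ih =>
    simp only [Finset.prod_insert ha]
    exact (h a (Finset.mem_insert_self _ _)).mul
      (ih fun i hi => h i (Finset.mem_insert_of_mem hi))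

lemma bddMeas_ite {s : ℕ} {A : P.Ω → Prop} [DecidablePred A] (hA : MeasurableSet[P.ℱ s] {ω | A ω}) :
    P.BddMeas s (fun ω => if A ω then (1 : ℝ) else 0) := by
  refine ⟨?_, 1, fun ω => ?_⟩
  · exact StronglyMeasurable.ite hA stronglyMeasurable_const stronglyMeasurable_const
  · simp only
    split_ifs <;> simp

variable (P)

/-- The steps up to time `s` are determined by the history up to time `s`. -/
lemma measurableSet_step {r s : ℕ} (h : r ≤ s) (A : Set (Bool × ℕ × ℕ)) :
    MeasurableSet[P.ℱ s] {ω | (P.Z r ω, P.ep r ω) ∈ A} := by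
  have : Measurable[P.ℱ s] fun ω => (P.Z r ω, P.ep r ω) :=
    ((P.Z_meas r).prodMk (P.ep_meas r)).mono (P.ℱ.mono h) le_rfl
  exact this (MeasurableSet.of_discrete)

lemma measurable_deg (s v : ℕ) : Measurable[P.ℱ s] (P.deg s v) := by
  unfold deg degOf
  refine Finset.measurable_fun_sum _ fun r hr => ?_
  have h : Measurable[P.ℱ s] (P.ep r) :=
    (P.ep_meas r).mono (P.ℱ.mono (Finset.mem_Icc.1 hr).2) le_rfl
  exact (Measurable.of_discrete (f := fun e : ℕ × ℕ =>
    (if e.1 = v then 1 else 0) + (if e.2 = v then 1 else 0))).comp h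

lemma deg_le (s v : ℕ) (ω : P.Ω) : P.deg s v ω ≤ 2 * s := by
  unfold deg degOf
  calc _ ≤ ∑ r ∈ Finset.Icc 1 s, 2 := Finset.sum_le_sum fun r _ => by split_ifs <;> simp
    _ = 2 * s := by simp [mul_comm]

lemma sum_deg_le (s : ℕ) (S : Finset ℕ) (ω : P.Ω) : ∑ v ∈ S, P.deg s v ω ≤ 2 * s := by
  unfold deg degOf
  rw [Finset.sum_comm]
  calc _ ≤ ∑ r ∈ Finset.Icc 1 s, 2 := Finset.sum_le_sum fun r _ => by
        rw [Finset.sum_add_distrib]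
        simp only [Finset.sum_ite_eq]
        split_ifs <;> simp
    _ = 2 * s := by simp [mul_comm]

lemma bddMeas_comp_deg (s v : ℕ) (f : ℕ → ℝ) : P.BddMeas s (fun ω => f (P.deg s v ω)) := by
  refine ⟨(Measurable.of_discrete.comp (P.measurable_deg s v)).stronglyMeasurable,
    ∑ d ∈ Finset.range (2 * s + 1), |f d|, fun ω => ?_⟩
  exact Finset.single_le_sum (f := fun d => |f d|) (fun _ _ => abs_nonneg _)
    (Finset.mem_range.2 (Nat.lt_succ_of_le (P.deg_le s v ω)))

lemma deg_succ (s v : ℕ) (ω : P.Ω) : P.deg (s + 1) v ω = P.deg s v ω +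
    ((if (P.ep (s + 1) ω).1 = v then 1 else 0) + (if (P.ep (s + 1) ω).2 = v then 1 else 0)) := by
  unfold deg degOf
  rw [Finset.sum_Icc_succ_top (by omega)]

lemma nv_le {s : ℕ} (hs : 1 ≤ s) (ω : P.Ω) : P.nv s ω ≤ s := by
  induction s, hs using Nat.le_induction with
  | base => simp [P.nv_one]
  | succ s hs ih =>
    rw [P.nv_succ s hs]
    split_ifs <;> omega

lemma deg_eq_zero {s : ℕ} (hs : 1 ≤ s) {v : ℕ} {ω : P.Ω} (hv : P.nv s ω < v) :
    P.deg s v ω = 0 := by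
  induction s, hs using Nat.le_induction with
  | base =>
    rw [P.nv_one] at hv
    simp [deg, degOf, P.ep_one, hv.ne]
  | succ s hs ih =>
    rw [P.nv_succ s hs] at hv
    rw [deg_succ, ih (by omega)]
    cases hZ : P.Z (s + 1) ω with
    | true =>
      have := P.ep_vertexStep s hs ω hZ
      simp only [hZ, if_true] at hv
      rw [if_neg (by omega), if_neg (by omega)]
    | false =>
      have := P.ep_edgeStep s hs ω hZ
      rw [if_neg (by omega), if_neg (by omega)]

/-- Integration against a conditional probability. -/
lemma integral_mul_ite {s : ℕ} {G g : P.Ω → ℝ} (hG : P.BddMeas s G) {A : P.Ω → Prop}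
    [DecidablePred A] (hA : MeasurableSet {ω | A ω})
    (h : P.μ[Set.indicator {ω | A ω} (fun _ => (1 : ℝ)) | P.ℱ s] =ᵐ[P.μ] g) :
    ∫ ω, G ω * (if A ω then 1 else 0) ∂P.μ = ∫ ω, G ω * g ω ∂P.μ := by
  have h1 : Integrable (Set.indicator {ω | A ω} (fun _ => (1 : ℝ))) P.μ :=
    (integrable_const 1).indicator hA
  have h2 : Integrable (G * Set.indicator {ω | A ω} (fun _ => (1 : ℝ))) P.μ := by
    obtain ⟨hm, C, hC⟩ := hG
    exact h1.bdd_mul (hm.mono (P.ℱ.le s)).aestronglyMeasurable (.of_forall hC)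
  have h3 : (fun ω => G ω * (if A ω then 1 else 0))
      = G * Set.indicator {ω | A ω} (fun _ => (1 : ℝ)) := by
    funext ω
    simp [Set.indicator_apply]
  rw [h3, ← integral_condExp (P.ℱ.le s)]
  refine integral_congr_ae ?_
  filter_upwards [condExp_mul_of_stronglyMeasurable_left hG.1 h2 h1, h] with ω h4 h5
  rw [h4, Pi.mul_apply, h5]

lemma integral_edge {s : ℕ} (hs : 1 ≤ s) {G : P.Ω → ℝ} (hG : P.BddMeas s G) (u w : ℕ) :
    ∫ ω, G ω * (if P.Z (s + 1) ω = false ∧ P.ep (s + 1) ω = (u, w) then 1 else 0) ∂P.μ =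
      ∫ ω, G ω * ((1 - p) * P.deg s u ω * P.deg s w ω / (2 * s) ^ 2) ∂P.μ := by
  refine P.integral_mul_ite hG ?_ (P.condLaw_edge s hs u w)
  exact P.ℱ.le (s + 1) _ (P.measurableSet_step le_rfl {z | z.1 = false ∧ z.2 = (u, w)})

lemma integral_vertex {s : ℕ} (hs : 1 ≤ s) {G : P.Ω → ℝ} (hG : P.BddMeas s G) (u : ℕ) :
    ∫ ω, G ω * (if P.Z (s + 1) ω = true ∧ (P.ep (s + 1) ω).1 = u then 1 else 0) ∂P.μ =
      ∫ ω, G ω * (p * P.deg s u ω / (2 * s)) ∂P.μ := by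
  refine P.integral_mul_ite hG ?_ ?_
  · exact P.ℱ.le (s + 1) _ (P.measurableSet_step le_rfl {z | z.1 = true ∧ z.2.1 = u})
  · refine EventuallyEq.trans (Eq.eventuallyEq ?_) (P.condLaw_vertex s hs u)
    congr 2
    ext ω
    refine and_congr_right fun hZ => ?_
    rw [Prod.ext_iff]
    simp [(P.ep_vertexStep s hs ω hZ).1]

lemma integral_edge_endpoint_le (hp : p ≤ 1) {s : ℕ} (hs : 1 ≤ s) {G : P.Ω → ℝ}
    (hG : P.BddMeas s G) (hG0 : ∀ ω, 0 ≤ G ω) {u : ℕ} {A : P.Ω → Prop} [DecidablePred A]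
    (e : ℕ → ℕ × ℕ) (he : ∀ w, e w = (u, w) ∨ e w = (w, u))
    (hA : ∀ ω, (if A ω then (1 : ℝ) else 0) = ∑ w ∈ Finset.Icc 1 s,
      if P.Z (s + 1) ω = false ∧ P.ep (s + 1) ω = e w then 1 else 0) :
    ∫ ω, G ω * (if A ω then 1 else 0) ∂P.μ ≤
      ∫ ω, G ω * ((1 - p) * P.deg s u ω / (2 * s)) ∂P.μ := by
  have hs' : (0 : ℝ) < s := by exact_mod_cast hs
  have hd : ∀ v, P.BddMeas s (fun ω => (P.deg s v ω : ℝ)) :=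
    fun v => P.bddMeas_comp_deg s v fun d => d
  calc _ = ∫ ω, ∑ w ∈ Finset.Icc 1 s, G ω *
        (if P.Z (s + 1) ω = false ∧ P.ep (s + 1) ω = e w then 1 else 0) ∂P.μ := by
        simp only [hA, Finset.mul_sum]
    _ = ∑ w ∈ Finset.Icc 1 s, ∫ ω, G ω *
        (if P.Z (s + 1) ω = false ∧ P.ep (s + 1) ω = e w then 1 else 0) ∂P.μ := by
        refine integral_finsetSum _ fun w _ => ?_
        exact ((hG.mono s.le_succ).mul (bddMeas_ite
          (A := fun ω => P.Z (s + 1) ω = false ∧ P.ep (s + 1) ω = e w)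
          (P.measurableSet_step le_rfl {z | z.1 = false ∧ z.2 = e w}))).integrable
    _ = ∑ w ∈ Finset.Icc 1 s, ∫ ω, G ω *
          ((1 - p) * P.deg s u ω * P.deg s w ω / (2 * s) ^ 2) ∂P.μ := by
        refine Finset.sum_congr rfl fun w _ => ?_
        rcases he w with h | h <;> rw [h, P.integral_edge hs hG]
        simp only [mul_right_comm]
    _ = ∫ ω, ∑ w ∈ Finset.Icc 1 s, G ω *
          ((1 - p) * P.deg s u ω * P.deg s w ω / (2 * s) ^ 2) ∂P.μ := by
        refine (integral_finsetSum _ fun w _ => ?_).symm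
        exact (hG.mul (((((bddMeas_const s (1 - p)).mul (hd u)).mul (hd w)).mul
          (bddMeas_const s ((2 * s : ℝ) ^ 2)⁻¹)))).integrable
    _ ≤ _ := by
        refine integral_mono_of_nonneg (.of_forall fun ω => ?_) ?_ (.of_forall fun ω => ?_)
        · have := hG0 ω
          have : 0 ≤ 1 - p := by linarith
          exact Finset.sum_nonneg fun w _ => by positivity
        · exact (hG.mul (((bddMeas_const s (1 - p)).mul (hd u)).mul
            (bddMeas_const s (2 * s : ℝ)⁻¹))).integrable
        · simp only
          rw [← Finset.mul_sum, ← Finset.sum_div, ← Finset.mul_sum]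
          have h1 : (∑ w ∈ Finset.Icc 1 s, (P.deg s w ω : ℝ)) ≤ 2 * s := by
            exact_mod_cast P.sum_deg_le s (Finset.Icc 1 s) ω
          have h2 : 0 ≤ 1 - p := by linarith
          refine mul_le_mul_of_nonneg_left ?_ (hG0 ω)
          rw [div_le_div_iff₀ (by positivity) (by positivity)]
          calc _ ≤ (1 - p) * P.deg s u ω * (2 * s) * (2 * s) := by gcongr
            _ = _ := by ring

lemma integral_edge_fst_le (hp : p ≤ 1) {s : ℕ} (hs : 1 ≤ s) {G : P.Ω → ℝ}
    (hG : P.BddMeas s G) (hG0 : ∀ ω, 0 ≤ G ω) (u : ℕ) :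
    ∫ ω, G ω * (if P.Z (s + 1) ω = false ∧ (P.ep (s + 1) ω).1 = u then 1 else 0) ∂P.μ ≤
      ∫ ω, G ω * ((1 - p) * P.deg s u ω / (2 * s)) ∂P.μ := by
  refine P.integral_edge_endpoint_le hp hs hG hG0 (fun w => (u, w)) (fun w => .inl rfl)
    fun ω => ?_
  by_cases hZ : P.Z (s + 1) ω = false
  · have := P.ep_edgeStep s hs ω hZ
    have := P.nv_le hs ω
    simp only [hZ, true_and, Prod.ext_iff, ite_and]
    split_ifs
    · rw [Finset.sum_ite_eq, if_pos (Finset.mem_Icc.2 (by omega))]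
    · simp
  · simp [hZ]

lemma integral_edge_snd_le (hp : p ≤ 1) {s : ℕ} (hs : 1 ≤ s) {G : P.Ω → ℝ}
    (hG : P.BddMeas s G) (hG0 : ∀ ω, 0 ≤ G ω) (u : ℕ) :
    ∫ ω, G ω * (if P.Z (s + 1) ω = false ∧ (P.ep (s + 1) ω).2 = u then 1 else 0) ∂P.μ ≤
      ∫ ω, G ω * ((1 - p) * P.deg s u ω / (2 * s)) ∂P.μ := by
  refine P.integral_edge_endpoint_le hp hs hG hG0 (fun w => (w, u)) (fun w => .inr rfl)
    fun ω => ?_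
  by_cases hZ : P.Z (s + 1) ω = false
  · have := P.ep_edgeStep s hs ω hZ
    have := P.nv_le hs ω
    simp only [hZ, true_and, Prod.ext_iff, and_comm (b := (P.ep (s + 1) ω).2 = u), ite_and]
    split_ifs
    · rw [Finset.sum_ite_eq, if_pos (Finset.mem_Icc.2 (by omega))]
    · simp
  · simp [hZ]

/-- The degree of `v` at time `s`, replaced by `1` before `v` appears. -/
noncomputable def posDeg (s v : ℕ) (ω : P.Ω) : ℕ := max (P.deg s v ω) 1

/-- Product over `v ∈ S` of rising factorials of order `m v` of the degrees at time `s`. -/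
noncomputable def degProd (S : Finset ℕ) (m : ℕ → ℕ) (s : ℕ) (ω : P.Ω) : ℝ :=
  ∏ v ∈ S, ((P.posDeg s v ω).ascFactorial (m v) : ℝ)

lemma one_le_posDeg (s v : ℕ) (ω : P.Ω) : 1 ≤ P.posDeg s v ω := le_max_right _ _

lemma bddMeas_posDeg (s v : ℕ) (f : ℕ → ℝ) : P.BddMeas s (fun ω => f (P.posDeg s v ω)) :=
  P.bddMeas_comp_deg s v fun d => f (max d 1)

lemma bddMeas_degProd (S : Finset ℕ) (m : ℕ → ℕ) (s : ℕ) :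
    P.BddMeas s (P.degProd S m s) :=
  BddMeas.prod fun v _ => P.bddMeas_posDeg s v fun d => (d.ascFactorial (m v) : ℝ)

lemma degProd_nonneg (S : Finset ℕ) (m : ℕ → ℕ) (s : ℕ) (ω : P.Ω) : 0 ≤ P.degProd S m s ω :=
  Finset.prod_nonneg fun _ _ => Nat.cast_nonneg _

lemma posDeg_succ_le {s : ℕ} (hs : 1 ≤ s) (v : ℕ) (ω : P.Ω) :
    P.posDeg (s + 1) v ω ≤ P.posDeg s v ω + (if (P.ep (s + 1) ω).1 = v then 1 else 0) +
      (if P.Z (s + 1) ω = false ∧ (P.ep (s + 1) ω).2 = v then 1 else 0) := by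
  unfold posDeg
  rw [deg_succ]
  cases hZ : P.Z (s + 1) ω with
  | false =>
    simp only [true_and]
    omega
  | true =>
    have h := P.ep_vertexStep s hs ω hZ
    by_cases hv : (P.ep (s + 1) ω).2 = v
    · have := P.deg_eq_zero hs (v := v) (ω := ω) (by omega)
      rw [if_neg (by omega)]
      simp only [this, hv, reduceCtorEq, false_and, if_false, if_true]
      omega
    · simp only [hv, and_false, if_false]
      omega

lemma ascFactorial_succ_left {d : ℕ} (hd : 1 ≤ d) (k : ℕ) :
    ((d + 1).ascFactorial k : ℝ) = (1 + k / d) * d.ascFactorial k := by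
  have h : (d : ℝ) * (d + 1).ascFactorial k = (d + k) * d.ascFactorial k := by
    exact_mod_cast Nat.succ_ascFactorial d k
  have : (d : ℝ) ≠ 0 := by positivity
  field_simp
  linarith

lemma ascFactorial_add_ite_le {d : ℕ} (hd : 1 ≤ d) (k : ℕ) (A B : Prop) [Decidable A]
    [Decidable B] :
    ((d + (if A then 1 else 0) + (if B then 1 else 0)).ascFactorial k : ℝ) ≤
      d.ascFactorial k * (if A then 1 + (k : ℝ) / d else 1) *
        (if B then 1 + (k : ℝ) / d else 1) := by
  have h1 := ascFactorial_succ_left hd k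
  have h2 := ascFactorial_succ_left (d := d + 1) (by omega) k
  have h3 : (k : ℝ) / (d + 1 : ℕ) ≤ k / d := by
    gcongr
    omega
  split_ifs
  · rw [h2, h1]
    calc _ ≤ (1 + (k : ℝ) / d) * ((1 + k / d) * d.ascFactorial k) := by gcongr
      _ = _ := by ring
  · simp only [add_zero, h1]
    exact le_of_eq (by ring)
  · simp only [add_zero, h1]
    exact le_of_eq (by ring)
  · simp

lemma prod_ite_one_add (S : Finset ℕ) (r : ℕ → ℝ) (u : ℕ) (A : Prop) [Decidable A] :
    ∏ v ∈ S, (if A ∧ u = v then 1 + r v else 1) =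
      1 + ∑ v ∈ S, r v * (if A ∧ u = v then 1 else 0) := by
  by_cases hA : A
  · simp only [hA, true_and]
    rw [Finset.prod_ite_eq]
    simp only [mul_ite, mul_one, mul_zero]
    rw [Finset.sum_ite_eq]
    split_ifs <;> simp
  · simp [hA]

/-- One step multiplies the rising factorial product by at most the relative increments coming
from the two endpoints. -/
lemma degProd_succ_le (S : Finset ℕ) (m : ℕ → ℕ) {s : ℕ} (hs : 1 ≤ s) (ω : P.Ω) :
    P.degProd S m (s + 1) ω ≤ P.degProd S m s ω *
      (1 + ∑ v ∈ S, (m v / P.posDeg s v ω : ℝ) *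
        (if True ∧ (P.ep (s + 1) ω).1 = v then 1 else 0)) *
      (1 + ∑ v ∈ S, (m v / P.posDeg s v ω : ℝ) *
        (if P.Z (s + 1) ω = false ∧ (P.ep (s + 1) ω).2 = v then 1 else 0)) := by
  rw [← prod_ite_one_add, ← prod_ite_one_add]
  unfold degProd
  rw [← Finset.prod_mul_distrib, ← Finset.prod_mul_distrib]
  refine Finset.prod_le_prod (fun _ _ => Nat.cast_nonneg _) fun v _ => ?_
  simp only [true_and]
  refine le_trans ?_ (ascFactorial_add_ite_le (P.one_le_posDeg s v ω) (m v) _ _)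
  exact_mod_cast Nat.ascFactorial_le (m v) (P.posDeg_succ_le hs v ω)

/-- The part of the exponent `m` carried by vertices that may be present at time `s`. -/
def activeExp (m : ℕ → ℕ) (s v : ℕ) : ℕ := if v ≤ s then m v else 0

lemma activeExp_le (m : ℕ → ℕ) (s v : ℕ) : activeExp m s v ≤ m v := by
  unfold activeExp
  split_ifs <;> simp

lemma relIncrement_mul_deg_le (m : ℕ → ℕ) {s : ℕ} (hs : 1 ≤ s) (v : ℕ) (ω : P.Ω) :
    (m v / P.posDeg s v ω : ℝ) * P.deg s v ω ≤ activeExp m s v := by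
  have h1 : (1 : ℝ) ≤ P.posDeg s v ω := by exact_mod_cast P.one_le_posDeg s v ω
  unfold activeExp
  split_ifs with hv
  · have h2 : (P.deg s v ω : ℝ) ≤ P.posDeg s v ω := by exact_mod_cast le_max_left _ _
    rw [div_mul_eq_mul_div, div_le_iff₀ (by positivity)]
    gcongr
  · have := P.nv_le hs ω
    rw [P.deg_eq_zero hs (by omega)]
    simp

lemma integral_mul_degProd_succ_le (hp0 : 0 ≤ p) (hp1 : p ≤ 1) (S : Finset ℕ) (m : ℕ → ℕ)
    {s : ℕ} (hs : 1 ≤ s) {H : P.Ω → ℝ} (hH : P.BddMeas s H) (hH0 : ∀ ω, 0 ≤ H ω) :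
    ∫ ω, H ω * P.degProd S m (s + 1) ω ∂P.μ ≤
      (1 + (1 - p / 2) / s * (∑ v ∈ S, activeExp m s v : ℕ) + (∑ v ∈ S, m v : ℕ) ^ 2 / s ^ 2) *
        ∫ ω, H ω * P.degProd S m s ω ∂P.μ := by
  have hs' : (0 : ℝ) < s := by exact_mod_cast hs
  have hp1' : 0 ≤ 1 - p := by linarith
  set G : P.Ω → ℝ := fun ω => H ω * P.degProd S m s ω with hG
  have hGb : P.BddMeas s G := hH.mul (P.bddMeas_degProd S m s)
  have hG0 : ∀ ω, 0 ≤ G ω := fun ω => mul_nonneg (hH0 ω) (P.degProd_nonneg S m s ω)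
  let r : ℕ → P.Ω → ℝ := fun v ω => m v / P.posDeg s v ω
  have hr0 : ∀ v ω, 0 ≤ r v ω := fun v ω => by positivity
  have hrb : ∀ v, P.BddMeas s (r v) := fun v => P.bddMeas_posDeg s v fun d => m v / d
  have hrd : ∀ v ω, r v ω * P.deg s v ω ≤ activeExp m s v :=
    fun v ω => P.relIncrement_mul_deg_le m hs v ω
  have hd : ∀ v, P.BddMeas s (fun ω => (P.deg s v ω : ℝ)) :=
    fun v => P.bddMeas_comp_deg s v fun d => d
  let V : ℕ → P.Ω → ℝ := fun v ω =>
    if P.Z (s + 1) ω = true ∧ (P.ep (s + 1) ω).1 = v then 1 else 0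
  let E₁ : ℕ → P.Ω → ℝ := fun v ω =>
    if P.Z (s + 1) ω = false ∧ (P.ep (s + 1) ω).1 = v then 1 else 0
  let E₂ : ℕ → P.Ω → ℝ := fun v ω =>
    if P.Z (s + 1) ω = false ∧ (P.ep (s + 1) ω).2 = v then 1 else 0
  let E : ℕ → ℕ → P.Ω → ℝ := fun v w ω =>
    if P.Z (s + 1) ω = false ∧ P.ep (s + 1) ω = (v, w) then 1 else 0
  have hV : ∀ v, P.BddMeas (s + 1) (V v) := fun v => bddMeas_ite
    (P.measurableSet_step le_rfl {z | z.1 = true ∧ z.2.1 = v})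
  have hE₁ : ∀ v, P.BddMeas (s + 1) (E₁ v) := fun v => bddMeas_ite
    (P.measurableSet_step le_rfl {z | z.1 = false ∧ z.2.1 = v})
  have hE₂ : ∀ v, P.BddMeas (s + 1) (E₂ v) := fun v => bddMeas_ite
    (P.measurableSet_step le_rfl {z | z.1 = false ∧ z.2.2 = v})
  have hE : ∀ v w, P.BddMeas (s + 1) (E v w) := fun v w => bddMeas_ite
    (P.measurableSet_step le_rfl {z | z.1 = false ∧ z.2 = (v, w)})
  have hGr : ∀ v, P.BddMeas s (fun ω => G ω * r v ω) := fun v => hGb.mul (hrb v)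
  have hGrr : ∀ v w, P.BddMeas s (fun ω => G ω * r v ω * r w ω) :=
    fun v w => (hGr v).mul (hrb w)
  have hi0 : Integrable G P.μ := hGb.integrable
  have hiV : ∀ v, Integrable (fun ω => G ω * r v ω * V v ω) P.μ :=
    fun v => (((hGr v).mono s.le_succ).mul (hV v)).integrable
  have hi1 : ∀ v, Integrable (fun ω => G ω * r v ω * E₁ v ω) P.μ :=
    fun v => (((hGr v).mono s.le_succ).mul (hE₁ v)).integrable
  have hi2 : ∀ v, Integrable (fun ω => G ω * r v ω * E₂ v ω) P.μ :=
    fun v => (((hGr v).mono s.le_succ).mul (hE₂ v)).integrable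
  have hi3 : ∀ v w, Integrable (fun ω => G ω * r v ω * r w ω * E v w ω) P.μ :=
    fun v w => (((hGrr v w).mono s.le_succ).mul (hE v w)).integrable
  have hpt : ∀ ω, H ω * P.degProd S m (s + 1) ω ≤ G ω + (∑ v ∈ S, G ω * r v ω * V v ω) +
      (∑ v ∈ S, G ω * r v ω * E₁ v ω) + (∑ v ∈ S, G ω * r v ω * E₂ v ω) +
      ∑ v ∈ S, ∑ w ∈ S, G ω * r v ω * r w ω * E v w ω := by
    intro ω
    refine (mul_le_mul_of_nonneg_left (P.degProd_succ_le S m hs ω) (hH0 ω)).trans (le_of_eq ?_)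
    have h1 : ∑ v ∈ S, (m v / P.posDeg s v ω : ℝ) *
        (if True ∧ (P.ep (s + 1) ω).1 = v then 1 else 0) =
        ∑ v ∈ S, r v ω * V v ω + ∑ v ∈ S, r v ω * E₁ v ω := by
      rw [← Finset.sum_add_distrib]
      refine Finset.sum_congr rfl fun v _ => ?_
      rw [← mul_add]
      congr 1
      simp only [V, E₁]
      cases P.Z (s + 1) ω <;> simp
    have h2 : (∑ v ∈ S, r v ω * V v ω + ∑ v ∈ S, r v ω * E₁ v ω) * ∑ v ∈ S, r v ω * E₂ v ω =
        ∑ v ∈ S, ∑ w ∈ S, r v ω * r w ω * E v w ω := by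
      rw [add_mul, Finset.sum_mul_sum, Finset.sum_mul_sum, ← Finset.sum_add_distrib]
      refine Finset.sum_congr rfl fun v _ => ?_
      rw [← Finset.sum_add_distrib]
      refine Finset.sum_congr rfl fun w _ => ?_
      simp only [V, E₁, E₂, E, Prod.ext_iff]
      cases P.Z (s + 1) ω
      · by_cases h3 : (P.ep (s + 1) ω).1 = v <;> by_cases h4 : (P.ep (s + 1) ω).2 = w <;>
          simp [h3, h4]
      · simp
    rw [h1]
    change H ω * (P.degProd S m s ω * (1 + (∑ v ∈ S, r v ω * V v ω + ∑ v ∈ S, r v ω * E₁ v ω)) *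
      (1 + ∑ v ∈ S, r v ω * E₂ v ω)) = _
    simp only [mul_assoc (G ω), ← Finset.mul_sum]
    rw [← h2]
    simp only [hG]
    ring
  have hcmp : ∀ {F : P.Ω → ℝ} (c : ℝ), (∀ ω, 0 ≤ F ω) → (∀ ω, F ω ≤ c) →
      ∫ ω, G ω * F ω ∂P.μ ≤ c * ∫ ω, G ω ∂P.μ := by
    intro F c hF0 hFc
    rw [mul_comm, ← integral_mul_const]
    exact integral_mono_of_nonneg (.of_forall fun ω => mul_nonneg (hG0 ω) (hF0 ω))
      (hi0.mul_const c) (.of_forall fun ω => mul_le_mul_of_nonneg_left (hFc ω) (hG0 ω))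
  have key : ∀ v (c : ℝ), 0 ≤ c → ∫ ω, G ω * r v ω * (c * P.deg s v ω / (2 * s)) ∂P.μ ≤
      c / (2 * s) * activeExp m s v * ∫ ω, G ω ∂P.μ := by
    intro v c hc
    simp only [mul_assoc (G _)]
    refine hcmp _ (fun ω => ?_) fun ω => ?_
    · have := hr0 v ω
      positivity
    · calc _ = c / (2 * s) * (r v ω * P.deg s v ω) := by ring
        _ ≤ _ := mul_le_mul_of_nonneg_left (hrd v ω) (by positivity)
  have bV : ∀ v, ∫ ω, G ω * r v ω * V v ω ∂P.μ ≤
      p / (2 * s) * activeExp m s v * ∫ ω, G ω ∂P.μ := fun v =>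
    (P.integral_vertex hs (hGr v) v).le.trans (key v p hp0)
  have b1 : ∀ v, ∫ ω, G ω * r v ω * E₁ v ω ∂P.μ ≤
      (1 - p) / (2 * s) * activeExp m s v * ∫ ω, G ω ∂P.μ := fun v =>
    (P.integral_edge_fst_le hp1 hs (hGr v) (fun ω => mul_nonneg (hG0 ω) (hr0 v ω)) v).trans
      (key v _ hp1')
  have b2 : ∀ v, ∫ ω, G ω * r v ω * E₂ v ω ∂P.μ ≤
      (1 - p) / (2 * s) * activeExp m s v * ∫ ω, G ω ∂P.μ := fun v =>
    (P.integral_edge_snd_le hp1 hs (hGr v) (fun ω => mul_nonneg (hG0 ω) (hr0 v ω)) v).trans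
      (key v _ hp1')
  have b3 : ∀ v w, ∫ ω, G ω * r v ω * r w ω * E v w ω ∂P.μ ≤
      (m v * m w : ℝ) / s ^ 2 * ∫ ω, G ω ∂P.μ := by
    intro v w
    refine (P.integral_edge hs (hGrr v w) v w).le.trans ?_
    simp only [mul_assoc (G _)]
    refine hcmp _ (fun ω => ?_) fun ω => ?_
    · have := hr0 v ω
      have := hr0 w ω
      positivity
    · have hv := (hrd v ω).trans (Nat.cast_le.2 (activeExp_le m s v))
      have hw := (hrd w ω).trans (Nat.cast_le.2 (activeExp_le m s w))
      have hv0 : 0 ≤ r v ω * P.deg s v ω := mul_nonneg (hr0 v ω) (Nat.cast_nonneg _)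
      have hw0 : 0 ≤ r w ω * P.deg s w ω := mul_nonneg (hr0 w ω) (Nat.cast_nonneg _)
      calc _ = (1 - p) / 4 * ((r v ω * P.deg s v ω) * (r w ω * P.deg s w ω) / s ^ 2) := by
            field_simp
            ring
        _ ≤ 1 * ((m v * m w : ℝ) / s ^ 2) := by gcongr; linarith
        _ = _ := one_mul _
  calc ∫ ω, H ω * P.degProd S m (s + 1) ω ∂P.μ
      ≤ ∫ ω, (G ω + (∑ v ∈ S, G ω * r v ω * V v ω) +
        (∑ v ∈ S, G ω * r v ω * E₁ v ω) + (∑ v ∈ S, G ω * r v ω * E₂ v ω) +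
        ∑ v ∈ S, ∑ w ∈ S, G ω * r v ω * r w ω * E v w ω) ∂P.μ := by
        refine integral_mono ((hH.mono s.le_succ).mul (P.bddMeas_degProd S m (s + 1))).integrable
          ?_ hpt
        exact ((((hi0.add (integrable_finsetSum _ fun v _ => hiV v)).add
          (integrable_finsetSum _ fun v _ => hi1 v)).add
          (integrable_finsetSum _ fun v _ => hi2 v)).add
          (integrable_finsetSum _ fun v _ => integrable_finsetSum _ fun w _ => hi3 v w))
    _ = ∫ ω, G ω ∂P.μ + ∑ v ∈ S, ∫ ω, G ω * r v ω * V v ω ∂P.μ +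
        ∑ v ∈ S, ∫ ω, G ω * r v ω * E₁ v ω ∂P.μ + ∑ v ∈ S, ∫ ω, G ω * r v ω * E₂ v ω ∂P.μ +
        ∑ v ∈ S, ∑ w ∈ S, ∫ ω, G ω * r v ω * r w ω * E v w ω ∂P.μ := by
        have i1 := integrable_finsetSum S fun v _ => hiV v
        have i2 := integrable_finsetSum S fun v _ => hi1 v
        have i3 := integrable_finsetSum S fun v _ => hi2 v
        have i4 := integrable_finsetSum S fun v _ => integrable_finsetSum S fun w _ => hi3 v w
        have i5 : Integrable (fun ω => G ω + ∑ v ∈ S, G ω * r v ω * V v ω) P.μ := hi0.add i1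
        have i6 : Integrable (fun ω => G ω + (∑ v ∈ S, G ω * r v ω * V v ω) +
          ∑ v ∈ S, G ω * r v ω * E₁ v ω) P.μ := i5.add i2
        have i7 : Integrable (fun ω => G ω + (∑ v ∈ S, G ω * r v ω * V v ω) +
          (∑ v ∈ S, G ω * r v ω * E₁ v ω) + ∑ v ∈ S, G ω * r v ω * E₂ v ω) P.μ := i6.add i3
        rw [integral_add i7 i4, integral_add i6 i3, integral_add i5 i2, integral_add hi0 i1,
          integral_finsetSum _ fun v _ => hiV v, integral_finsetSum _ fun v _ => hi1 v,
          integral_finsetSum _ fun v _ => hi2 v,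
          integral_finsetSum _ fun v _ => integrable_finsetSum S fun w _ => hi3 v w]
        simp only [integral_finsetSum _ fun w _ => hi3 _ w]
    _ ≤ ∫ ω, G ω ∂P.μ + ∑ v ∈ S, p / (2 * s) * activeExp m s v * ∫ ω, G ω ∂P.μ +
        ∑ v ∈ S, (1 - p) / (2 * s) * activeExp m s v * ∫ ω, G ω ∂P.μ +
        ∑ v ∈ S, (1 - p) / (2 * s) * activeExp m s v * ∫ ω, G ω ∂P.μ +
        ∑ v ∈ S, ∑ w ∈ S, (m v * m w : ℝ) / s ^ 2 * ∫ ω, G ω ∂P.μ := by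
        gcongr with v _ v _ v _ v _ w _
        · exact bV v
        · exact b1 v
        · exact b2 v
        · exact b3 v w
    _ = _ := by
        simp only [← Finset.sum_mul, ← Finset.mul_sum, ← Finset.sum_div]
        push_cast
        field_simp
        ring

/-- Growth rate up to time `s` of the expected degree of vertex `v`. -/
noncomputable def growth (a : ℝ) (s v : ℕ) : ℝ := ∏ r ∈ Finset.Ico v s, (1 + a / r)

/-- Growth rate of the expectation of `degProd S m`. -/
noncomputable def growthProd (a : ℝ) (S : Finset ℕ) (m : ℕ → ℕ) (s : ℕ) : ℝ :=
  ∏ v ∈ S, growth a s v ^ m v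

lemma growth_pos {a : ℝ} (ha : 0 ≤ a) (s v : ℕ) : 0 < growth a s v :=
  Finset.prod_pos fun _ _ => by positivity

lemma growthProd_pos {a : ℝ} (ha : 0 ≤ a) (S : Finset ℕ) (m : ℕ → ℕ) (s : ℕ) :
    0 < growthProd a S m s :=
  Finset.prod_pos fun v _ => pow_pos (growth_pos ha s v) _

lemma growth_succ (a : ℝ) (s v : ℕ) :
    growth a (s + 1) v = growth a s v * (if v ≤ s then 1 + a / s else 1) := by
  unfold growth
  split_ifs with h
  · rw [Finset.prod_Ico_succ_top h]
  · rw [Finset.Ico_eq_empty (by omega), Finset.Ico_eq_empty (by omega)]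
    simp

lemma growthProd_succ (a : ℝ) (S : Finset ℕ) (m : ℕ → ℕ) (s : ℕ) :
    growthProd a S m (s + 1) =
      growthProd a S m s * (1 + a / s) ^ (∑ v ∈ S, activeExp m s v) := by
  unfold growthProd
  rw [← Finset.prod_pow_eq_pow_sum, ← Finset.prod_mul_distrib]
  refine Finset.prod_congr rfl fun v _ => ?_
  rw [growth_succ, mul_pow]
  unfold activeExp
  split_ifs <;> simp

lemma growthProd_add_single (a : ℝ) {S : Finset ℕ} (m : ℕ → ℕ) (s : ℕ) {x : ℕ} (hx : x ∈ S) :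
    growthProd a S (m + Pi.single x 1) s = growthProd a S m s * growth a s x := by
  unfold growthProd
  simp only [Pi.add_apply, pow_add, Finset.prod_mul_distrib]
  congr 1
  rw [Finset.prod_eq_single_of_mem x hx fun v _ hv => by simp [hv]]
  simp

lemma growth_le {a : ℝ} (ha0 : 0 ≤ a) (ha1 : a ≤ 1) {s v : ℕ} (hv : 1 ≤ v) (hs : v ≤ s) :
    growth a s v ≤ Real.exp 1 * ((s : ℝ) / v) ^ a := by
  have hv' : (0 : ℝ) < v := by exact_mod_cast hv
  have key : growth a s v * Real.exp (a / s) ≤ Real.exp (a / v) * ((s : ℝ) / v) ^ a := by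
    induction s, hs using Nat.le_induction with
    | base => simp [growth, hv'.ne']
    | succ s hs ih =>
      have hs' : (0 : ℝ) < s := by exact_mod_cast hv.trans hs
      rw [growth_succ, if_pos hs]
      have h1 : Real.exp (a / (s + 1)) ≤ (((s : ℝ) + 1) / s) ^ a := by
        have h2 : Real.exp (1 / ((s : ℝ) + 1)) ≤ ((s : ℝ) + 1) / s := by
          have h3 := Real.add_one_le_exp (-(1 / ((s : ℝ) + 1)))
          rw [Real.exp_neg] at h3
          have h4 : -(1 / ((s : ℝ) + 1)) + 1 = (((s : ℝ) + 1) / s)⁻¹ := by field_simp; ring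
          rw [h4] at h3
          exact (inv_le_inv₀ (by positivity) (Real.exp_pos _)).1 h3
        calc _ = Real.exp (1 / ((s : ℝ) + 1)) ^ a := by
              rw [← Real.exp_mul]
              congr 1
              ring
          _ ≤ _ := Real.rpow_le_rpow (Real.exp_pos _).le h2 ha0
      have h5 : 1 + a / s ≤ Real.exp (a / s) := by
        have := Real.add_one_le_exp (a / s)
        linarith
      have h6 := (growth_pos ha0 s v).le
      push_cast
      calc growth a s v * (1 + a / s) * Real.exp (a / (s + 1))
          ≤ growth a s v * Real.exp (a / s) * (((s : ℝ) + 1) / s) ^ a := by gcongr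
        _ ≤ Real.exp (a / v) * ((s : ℝ) / v) ^ a * (((s : ℝ) + 1) / s) ^ a := by gcongr
        _ = _ := by
          rw [mul_assoc, ← Real.mul_rpow (by positivity) (by positivity)]
          congr 2
          field_simp
  have h1 : 1 ≤ Real.exp (a / s) := Real.one_le_exp (by positivity)
  have h2 : Real.exp (a / v) ≤ Real.exp 1 := by
    rw [Real.exp_le_exp, div_le_one hv']
    exact ha1.trans (by exact_mod_cast hv)
  calc growth a s v ≤ growth a s v * Real.exp (a / s) :=
        le_mul_of_one_le_right (growth_pos ha0 s v).le h1
    _ ≤ _ := key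
    _ ≤ _ := by gcongr

lemma sum_inv_sq_le {s t : ℕ} (hs : 1 ≤ s) (hst : s ≤ t) :
    ∑ r ∈ Finset.Ico s t, 1 / (r : ℝ) ^ 2 ≤ 2 := by
  have key : ∑ r ∈ Finset.Ico s t, 1 / (r : ℝ) ^ 2 + 2 / (t : ℝ) ≤ 2 := by
    induction t, hst using Nat.le_induction with
    | base =>
      have : (1 : ℝ) ≤ s := by exact_mod_cast hs
      simp only [Finset.Ico_self, Finset.sum_empty, zero_add]
      rw [div_le_iff₀ (by positivity)]
      linarith
    | succ t hst ih =>
      have h1 : (1 : ℝ) ≤ t := by exact_mod_cast hs.trans hst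
      rw [Finset.sum_Ico_succ_top hst]
      have h2 : 1 / (t : ℝ) ^ 2 + 2 / (t + 1) ≤ 2 / t := by
        rw [div_add_div _ _ (by positivity) (by positivity),
          div_le_div_iff₀ (by positivity) (by positivity)]
        nlinarith [sq_nonneg (t : ℝ), pow_pos (by linarith : (0 : ℝ) < t) 3]
      push_cast
      linarith
  have : (0 : ℝ) ≤ 2 / t := by positivity
  linarith

/-- The expectation of `H * degProd S m s`, normalized by its growth rate. -/
noncomputable def normExp (S : Finset ℕ) (m : ℕ → ℕ) (s : ℕ) (H : P.Ω → ℝ) : ℝ :=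
  (∫ ω, H ω * P.degProd S m s ω ∂P.μ) / growthProd (1 - p / 2) S m s

lemma normExp_nonneg (hp1 : p ≤ 1) (S : Finset ℕ) (m : ℕ → ℕ) (s : ℕ) {H : P.Ω → ℝ}
    (hH0 : ∀ ω, 0 ≤ H ω) : 0 ≤ P.normExp S m s H :=
  div_nonneg (integral_nonneg fun ω => mul_nonneg (hH0 ω) (P.degProd_nonneg S m s ω))
    (growthProd_pos (by linarith) S m s).le

lemma normExp_succ_le (hp0 : 0 ≤ p) (hp1 : p ≤ 1) (S : Finset ℕ) (m : ℕ → ℕ)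
    {s : ℕ} (hs : 1 ≤ s) {H : P.Ω → ℝ} (hH : P.BddMeas s H) (hH0 : ∀ ω, 0 ≤ H ω) :
    P.normExp S m (s + 1) H ≤ (1 + (∑ v ∈ S, m v : ℕ) ^ 2 / s ^ 2) * P.normExp S m s H := by
  have ha : 0 ≤ 1 - p / 2 := by linarith
  have hI : 0 ≤ ∫ ω, H ω * P.degProd S m s ω ∂P.μ :=
    integral_nonneg fun ω => mul_nonneg (hH0 ω) (P.degProd_nonneg S m s ω)
  have hg := growthProd_pos ha S m s
  have h1 := P.integral_mul_degProd_succ_le hp0 hp1 S m hs hH hH0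
  unfold normExp
  rw [growthProd_succ, div_le_iff₀ (by positivity)]
  have h2 := one_add_mul_le_pow (a := (1 - p / 2) / s)
    (le_trans (by norm_num) (by positivity : 0 ≤ (1 - p / 2) / s)) (∑ v ∈ S, activeExp m s v)
  set k := ∑ v ∈ S, activeExp m s v
  set M := ∑ v ∈ S, m v
  have h3 : 1 + (1 - p / 2) / s * k + (M : ℝ) ^ 2 / s ^ 2 ≤
      (1 + (M : ℝ) ^ 2 / s ^ 2) * (1 + (1 - p / 2) / s) ^ k := by
    have h4 : 1 ≤ (1 + (1 - p / 2) / s) ^ k :=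
      one_le_pow₀ (le_add_of_nonneg_right (by positivity))
    have h5 : 0 ≤ (M : ℝ) ^ 2 / s ^ 2 := by positivity
    nlinarith
  refine h1.trans ((mul_le_mul_of_nonneg_right h3 hI).trans (le_of_eq ?_))
  generalize growthProd (1 - p / 2) S m s = g at hg
  generalize (1 + (1 - p / 2) / s) ^ k = c
  field_simp

lemma normExp_le_of_le (hp0 : 0 ≤ p) (hp1 : p ≤ 1) {S : Finset ℕ} {m : ℕ → ℕ} {M : ℕ}
    (hM : ∑ v ∈ S, m v ≤ M) {s t : ℕ} (hs : 1 ≤ s) (hst : s ≤ t) {H : P.Ω → ℝ}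
    (hH : P.BddMeas s H) (hH0 : ∀ ω, 0 ≤ H ω) :
    P.normExp S m t H ≤ Real.exp (M ^ 2 * 2) * P.normExp S m s H := by
  have key : P.normExp S m t H ≤
      Real.exp (M ^ 2 * ∑ r ∈ Finset.Ico s t, 1 / (r : ℝ) ^ 2) * P.normExp S m s H := by
    induction t, hst using Nat.le_induction with
    | base => simp
    | succ t hst ih =>
      have h0 := P.normExp_nonneg hp1 S m t hH0
      rw [Finset.sum_Ico_succ_top hst, mul_add, Real.exp_add]
      calc P.normExp S m (t + 1) H
          ≤ (1 + (∑ v ∈ S, m v : ℕ) ^ 2 / t ^ 2) * P.normExp S m t H :=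
            P.normExp_succ_le hp0 hp1 S m (hs.trans hst) (hH.mono hst) hH0
        _ ≤ (1 + (M : ℝ) ^ 2 * (1 / t ^ 2)) * P.normExp S m t H := by
            rw [mul_one_div]
            gcongr
        _ ≤ Real.exp (M ^ 2 * (1 / t ^ 2)) * P.normExp S m t H := by
            gcongr
            rw [add_comm]
            exact Real.add_one_le_exp _
        _ ≤ Real.exp (M ^ 2 * (1 / t ^ 2)) * (Real.exp (M ^ 2 * ∑ r ∈ Finset.Ico s t,
              1 / (r : ℝ) ^ 2) * P.normExp S m s H) := by gcongr
        _ = _ := by ring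
  refine key.trans ?_
  have := P.normExp_nonneg hp1 S m s hH0
  gcongr
  exact sum_inv_sq_le hs hst

lemma normExp_one_le {S : Finset ℕ} {m : ℕ → ℕ} {M : ℕ}
    (hM : ∑ v ∈ S, m v ≤ M) : P.normExp S m 1 (fun _ => 1) ≤ ((M + 1).factorial : ℝ) ^ S.card := by
  have h1 : growthProd (1 - p / 2) S m 1 = 1 := by
    refine Finset.prod_eq_one fun v _ => ?_
    have : growth (1 - p / 2) 1 v = 1 := Finset.prod_eq_one fun r hr => by
      have : r = 0 := by have := Finset.mem_Ico.1 hr; omega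
      simp [this]
    simp [this]
  have h2 : ∀ ω, P.degProd S m 1 ω ≤ ((M + 1).factorial : ℝ) ^ S.card := fun ω => by
    refine le_trans (Finset.prod_le_prod (fun _ _ => Nat.cast_nonneg _)
      (g := fun _ => ((M + 1).factorial : ℝ)) fun v hv => ?_) (Finset.prod_const _).le
    have h3 : P.posDeg 1 v ω ≤ 2 := max_le (P.deg_le 1 v ω) (by norm_num)
    have h4 : (2 : ℕ).ascFactorial (m v) = (1 + m v).factorial := by
      simpa using Nat.factorial_mul_ascFactorial 1 (m v)
    have h5 : m v ≤ M := (Finset.single_le_sum (fun _ _ => Nat.zero_le _) hv).trans hM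
    exact_mod_cast (Nat.ascFactorial_le (m v) h3).trans
      (h4.le.trans (Nat.factorial_le (by omega)))
  unfold normExp
  rw [h1, div_one]
  calc _ ≤ ∫ _, ((M + 1).factorial : ℝ) ^ S.card ∂P.μ := by
        refine integral_mono ((bddMeas_const 1 1).mul (P.bddMeas_degProd S m 1)).integrable
          (integrable_const _) fun ω => ?_
        simpa using h2 ω
    _ = _ := by simp

lemma ite_or_le_add (A B : Prop) [Decidable A] [Decidable B] [Decidable (A ∨ B)] :
    (if A ∨ B then (1 : ℝ) else 0) ≤ (if A then 1 else 0) + (if B then 1 else 0) := by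
  by_cases hA : A <;> by_cases hB : B <;> simp [hA, hB]

/-- Indicator that an edge-step joins `x` and `y` at time `s`. -/
noncomputable def edgeInd (x y s : ℕ) (ω : P.Ω) : ℝ :=
  if P.Z s ω = false ∧ (P.ep s ω = (x, y) ∨ P.ep s ω = (y, x)) then 1 else 0

lemma edgeInd_nonneg (x y s : ℕ) (ω : P.Ω) : 0 ≤ P.edgeInd x y s ω := by
  unfold edgeInd
  split_ifs <;> simp

lemma bddMeas_edgeInd (x y s : ℕ) : P.BddMeas s (P.edgeInd x y s) :=
  bddMeas_ite (P.measurableSet_step le_rfl {z | z.1 = false ∧ (z.2 = (x, y) ∨ z.2 = (y, x))})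

lemma degProd_mul_deg_le {S : Finset ℕ} (m : ℕ → ℕ) (s : ℕ) {x : ℕ} (hx : x ∈ S) (ω : P.Ω) :
    P.degProd S m s ω * P.deg s x ω ≤ P.degProd S (m + Pi.single x 1) s ω := by
  unfold degProd
  rw [← Finset.mul_prod_erase S _ hx, ← Finset.mul_prod_erase S _ hx]
  have h1 : ∏ v ∈ S.erase x, ((P.posDeg s v ω).ascFactorial ((m + Pi.single x 1 : ℕ → ℕ) v) : ℝ) =
      ∏ v ∈ S.erase x, ((P.posDeg s v ω).ascFactorial (m v) : ℝ) :=
    Finset.prod_congr rfl fun v hv => by simp [(Finset.mem_erase.1 hv).1]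
  rw [h1, mul_right_comm]
  refine mul_le_mul_of_nonneg_right ?_ (Finset.prod_nonneg fun _ _ => Nat.cast_nonneg _)
  simp only [Pi.add_apply, Pi.single_eq_same, Nat.ascFactorial_succ]
  rw [mul_comm]
  norm_cast
  gcongr
  exact (le_max_left _ _).trans (Nat.le_add_right _ _)

lemma degProd_succ_le_mul {S : Finset ℕ} {m : ℕ → ℕ} {M : ℕ} (hM : ∑ v ∈ S, m v ≤ M) {s : ℕ}
    (hs : 1 ≤ s) (ω : P.Ω) : P.degProd S m (s + 1) ω ≤ (1 + M) ^ 2 * P.degProd S m s ω := by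
  have h0 := P.degProd_nonneg S m s ω
  have h1 : ∀ (A : ℕ → Prop) [DecidablePred A],
      ∑ v ∈ S, (m v / P.posDeg s v ω : ℝ) * (if A v then 1 else 0) ≤ M := by
    intro A _
    refine le_trans (Finset.sum_le_sum (g := fun v => (m v : ℝ)) fun v _ => ?_)
      (by exact_mod_cast hM)
    have h2 : (1 : ℝ) ≤ P.posDeg s v ω := by exact_mod_cast P.one_le_posDeg s v ω
    have h3 : (m v / P.posDeg s v ω : ℝ) ≤ m v := div_le_self (Nat.cast_nonneg _) h2
    split_ifs
    · simpa using h3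
    · simp
  refine (P.degProd_succ_le S m hs ω).trans ?_
  have h4 : ∀ (A : ℕ → Prop) [DecidablePred A],
      0 ≤ ∑ v ∈ S, (m v / P.posDeg s v ω : ℝ) * (if A v then 1 else 0) := fun A _ =>
    Finset.sum_nonneg fun v _ => by positivity
  calc _ ≤ P.degProd S m s ω * (1 + M) * (1 + M) := by
        have h5 := h1 fun v => True ∧ (P.ep (s + 1) ω).1 = v
        have h6 := h1 fun v => P.Z (s + 1) ω = false ∧ (P.ep (s + 1) ω).2 = v
        have h7 := h4 fun v => P.Z (s + 1) ω = false ∧ (P.ep (s + 1) ω).2 = v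
        gcongr
    _ = _ := by ring

/-- The order of magnitude of the probability that an edge-step joins `x` and `y` at
time `r + 1`. -/
noncomputable def edgeRate (p : ℝ) (x y r : ℕ) : ℝ :=
  (r : ℝ) ^ (-p) * ((x : ℝ) * y) ^ (-(1 - p / 2))

lemma edgeRate_nonneg (p : ℝ) (x y r : ℕ) : 0 ≤ edgeRate p x y r := by
  unfold edgeRate
  positivity

lemma normExp_edge_le (hp0 : 0 ≤ p) (hp1 : p ≤ 1) {S : Finset ℕ} {m : ℕ → ℕ} {M : ℕ}
    (hM : ∑ v ∈ S, m v ≤ M) {x y : ℕ} (hx : x ∈ S) (hy : y ∈ S) (hx1 : 1 ≤ x) (hy1 : 1 ≤ y)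
    {s : ℕ} (hs : 1 ≤ s) {H : P.Ω → ℝ} (hH : P.BddMeas s H) (hH0 : ∀ ω, 0 ≤ H ω) :
    P.normExp S m (s + 1) (fun ω => H ω * P.edgeInd x y (s + 1) ω) ≤
      (1 + M) ^ 2 * Real.exp 2 * edgeRate p x y s *
        P.normExp S (m + Pi.single x 1 + Pi.single y 1) s H := by
  have ha0 : 0 ≤ 1 - p / 2 := by linarith
  have ha1 : 1 - p / 2 ≤ 1 := by linarith
  have hs' : (0 : ℝ) < s := by exact_mod_cast hs
  have hx' : (0 : ℝ) < x := by exact_mod_cast hx1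
  have hy' : (0 : ℝ) < y := by exact_mod_cast hy1
  set G : P.Ω → ℝ := fun ω => H ω * P.degProd S m s ω with hG
  have hGb : P.BddMeas s G := hH.mul (P.bddMeas_degProd S m s)
  have hG0 : ∀ ω, 0 ≤ G ω := fun ω => mul_nonneg (hH0 ω) (P.degProd_nonneg S m s ω)
  have hd : ∀ v, P.BddMeas s (fun ω => (P.deg s v ω : ℝ)) :=
    fun v => P.bddMeas_comp_deg s v fun d => d
  let E : ℕ → ℕ → P.Ω → ℝ := fun v w ω =>
    if P.Z (s + 1) ω = false ∧ P.ep (s + 1) ω = (v, w) then 1 else 0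
  have hE : ∀ v w, P.BddMeas (s + 1) (E v w) := fun v w => bddMeas_ite
    (P.measurableSet_step le_rfl {z | z.1 = false ∧ z.2 = (v, w)})
  have hGE : ∀ v w, P.BddMeas (s + 1) (fun ω => G ω * E v w ω) :=
    fun v w => (hGb.mono s.le_succ).mul (hE v w)
  have hGd : P.BddMeas s (fun ω => G ω * (P.deg s x ω * P.deg s y ω)) :=
    hGb.mul ((hd x).mul (hd y))
  have h1 : ∫ ω, H ω * P.edgeInd x y (s + 1) ω * P.degProd S m (s + 1) ω ∂P.μ ≤
      (1 + M) ^ 2 / s ^ 2 * ∫ ω, G ω * (P.deg s x ω * P.deg s y ω) ∂P.μ := by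
    calc _ ≤ ∫ ω, (1 + M : ℝ) ^ 2 * (G ω * E x y ω + G ω * E y x ω) ∂P.μ := by
          refine integral_mono (((hH.mono s.le_succ).mul (P.bddMeas_edgeInd x y (s + 1))).mul
            (P.bddMeas_degProd S m (s + 1))).integrable
            (((hGE x y).add (hGE y x)).integrable.const_mul _) fun ω => ?_
          have h2 : P.edgeInd x y (s + 1) ω ≤ E x y ω + E y x ω := by
            simp only [edgeInd, E, and_or_left]
            exact ite_or_le_add _ _
          calc _ ≤ H ω * (E x y ω + E y x ω) * ((1 + M) ^ 2 * P.degProd S m s ω) := by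
                have := hH0 ω
                have := P.edgeInd_nonneg x y (s + 1) ω
                have := P.degProd_nonneg S m (s + 1) ω
                have := P.degProd_succ_le_mul hM hs ω
                gcongr
            _ = _ := by simp only [hG]; ring
      _ = (1 + M : ℝ) ^ 2 * (∫ ω, G ω * E x y ω ∂P.μ + ∫ ω, G ω * E y x ω ∂P.μ) := by
          rw [integral_const_mul, integral_add (hGE x y).integrable (hGE y x).integrable]
      _ = (1 + M : ℝ) ^ 2 * ((1 - p) / (2 * s ^ 2) *
            ∫ ω, G ω * (P.deg s x ω * P.deg s y ω) ∂P.μ) := by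
          simp only [E, P.integral_edge hs hGb]
          rw [← integral_const_mul, ← integral_add]
          · congr 1
            refine integral_congr_ae (.of_forall fun ω => ?_)
            simp only
            field_simp
            ring
          · exact (hGb.mul ((((bddMeas_const s (1 - p)).mul (hd x)).mul (hd y)).mul
              (bddMeas_const s ((2 * s : ℝ) ^ 2)⁻¹))).integrable
          · exact (hGb.mul ((((bddMeas_const s (1 - p)).mul (hd y)).mul (hd x)).mul
              (bddMeas_const s ((2 * s : ℝ) ^ 2)⁻¹))).integrable
      _ ≤ (1 + M : ℝ) ^ 2 * (1 / s ^ 2 * ∫ ω, G ω * (P.deg s x ω * P.deg s y ω) ∂P.μ) := by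
          have : 0 ≤ ∫ ω, G ω * (P.deg s x ω * P.deg s y ω) ∂P.μ :=
            integral_nonneg fun ω => mul_nonneg (hG0 ω) (by positivity)
          gcongr
          · linarith
          · linarith [sq_nonneg (s : ℝ)]
      _ = _ := by ring
  have hR := edgeRate_nonneg p x y s
  have hN := P.normExp_nonneg hp1 S (m + Pi.single x 1 + Pi.single y 1) s hH0
  by_cases hxy : x ≤ s ∧ y ≤ s
  · obtain ⟨hxs, hys⟩ := hxy
    have h2 : ∫ ω, G ω * (P.deg s x ω * P.deg s y ω) ∂P.μ ≤
        ∫ ω, H ω * P.degProd S (m + Pi.single x 1 + Pi.single y 1) s ω ∂P.μ := by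
      refine integral_mono hGd.integrable (hH.mul (P.bddMeas_degProd S _ s)).integrable
        fun ω => ?_
      simp only [hG, mul_assoc]
      refine mul_le_mul_of_nonneg_left ?_ (hH0 ω)
      rw [← mul_assoc]
      exact (mul_le_mul_of_nonneg_right (P.degProd_mul_deg_le m s hx ω)
        (Nat.cast_nonneg _)).trans (P.degProd_mul_deg_le _ s hy ω)
    have hg := growthProd_pos ha0 S m s
    have hgx := growth_pos ha0 s x
    have hgy := growth_pos ha0 s y
    have h3 : growth (1 - p / 2) s x * growth (1 - p / 2) s y / s ^ 2 ≤
        Real.exp 2 * edgeRate p x y s := by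
      have h4 := growth_le ha0 ha1 hx1 hxs
      have h5 := growth_le ha0 ha1 hy1 hys
      calc _ ≤ (Real.exp 1 * ((s : ℝ) / x) ^ (1 - p / 2)) *
            (Real.exp 1 * ((s : ℝ) / y) ^ (1 - p / 2)) / s ^ 2 := by gcongr
        _ = _ := by
          unfold edgeRate
          have h6 : (s : ℝ) ^ (-p) = s ^ (1 - p / 2) * s ^ (1 - p / 2) / s ^ 2 := by
            rw [← Real.rpow_add hs', ← Real.rpow_natCast, ← Real.rpow_sub hs']
            congr 1
            push_cast
            ring
          have h7 : Real.exp 2 = Real.exp 1 * Real.exp 1 := by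
            rw [← Real.exp_add]
            norm_num
          rw [h6, h7, Real.rpow_neg (by positivity), Real.mul_rpow hx'.le hy'.le,
            Real.div_rpow hs'.le hx'.le, Real.div_rpow hs'.le hy'.le]
          field_simp
    have h8 : growthProd (1 - p / 2) S m s ≤ growthProd (1 - p / 2) S m (s + 1) := by
      rw [growthProd_succ]
      exact le_mul_of_one_le_right hg.le
        (one_le_pow₀ (le_add_of_nonneg_right (by positivity)))
    unfold normExp
    rw [growthProd_add_single _ _ _ hy, growthProd_add_single _ _ _ hx]
    set J := ∫ ω, H ω * P.degProd S (m + Pi.single x 1 + Pi.single y 1) s ω ∂P.μ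
    have hJ : 0 ≤ J := integral_nonneg fun ω => mul_nonneg (hH0 ω) (P.degProd_nonneg S _ s ω)
    calc _ ≤ ((1 + M) ^ 2 / s ^ 2 * J) / growthProd (1 - p / 2) S m s := by
          refine div_le_div₀ (by positivity) (h1.trans ?_) hg h8
          gcongr
      _ = (1 + M) ^ 2 * (growth (1 - p / 2) s x * growth (1 - p / 2) s y / s ^ 2) *
          (J / (growthProd (1 - p / 2) S m s * growth (1 - p / 2) s x *
            growth (1 - p / 2) s y)) := by
          generalize growthProd (1 - p / 2) S m s = g at hg
          generalize growth (1 - p / 2) s x = gx at hgx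
          generalize growth (1 - p / 2) s y = gy at hgy
          field_simp
      _ ≤ (1 + M) ^ 2 * (Real.exp 2 * edgeRate p x y s) *
          (J / (growthProd (1 - p / 2) S m s * growth (1 - p / 2) s x *
            growth (1 - p / 2) s y)) := by gcongr
      _ = _ := by ring
  · have h2 : ∫ ω, G ω * (P.deg s x ω * P.deg s y ω) ∂P.μ = 0 := by
      refine integral_eq_zero_of_ae (.of_forall fun ω => ?_)
      have := P.nv_le hs ω
      rcases not_and_or.1 hxy with h | h
      · simp [P.deg_eq_zero hs (show P.nv s ω < x by omega)]
      · simp [P.deg_eq_zero hs (show P.nv s ω < y by omega)]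
    rw [h2, mul_zero] at h1
    exact (div_nonpos_of_nonpos_of_nonneg h1 (growthProd_pos ha0 S m (s + 1)).le).trans
      (by positivity)

lemma sum_add_single_le (S : Finset ℕ) (m : ℕ → ℕ) (x : ℕ) :
    ∑ v ∈ S, (m + Pi.single x 1 : ℕ → ℕ) v ≤ ∑ v ∈ S, m v + 1 := by
  simp only [Pi.add_apply, Finset.sum_add_distrib]
  gcongr
  simp only [Pi.single_apply, Finset.sum_ite_eq']
  split_ifs <;> simp

lemma normExp_edge_le_of_lt (hp0 : 0 ≤ p) (hp1 : p ≤ 1) {S : Finset ℕ} {m : ℕ → ℕ} {M : ℕ}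
    (hM : ∑ v ∈ S, m v + 2 ≤ M) {x y : ℕ} (hx : x ∈ S) (hy : y ∈ S) (hx1 : 1 ≤ x) (hy1 : 1 ≤ y)
    {r s : ℕ} (hr : 1 ≤ r) (hrs : r ≤ s) {H : P.Ω → ℝ} (hH : P.BddMeas r H)
    (hH0 : ∀ ω, 0 ≤ H ω) :
    P.normExp S m (s + 1) (fun ω => H ω * P.edgeInd x y (s + 1) ω) ≤
      (1 + M) ^ 2 * Real.exp 2 * Real.exp (M ^ 2 * 2) * edgeRate p x y s *
        P.normExp S (m + Pi.single x 1 + Pi.single y 1) r H := by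
  have hM' : ∑ v ∈ S, (m + Pi.single x 1 + Pi.single y 1 : ℕ → ℕ) v ≤ M :=
    (sum_add_single_le S _ y).trans
      ((Nat.add_le_add_right (sum_add_single_le S m x) 1).trans hM)
  have hR := edgeRate_nonneg p x y s
  calc _ ≤ (1 + M) ^ 2 * Real.exp 2 * edgeRate p x y s *
        P.normExp S (m + Pi.single x 1 + Pi.single y 1) s H :=
        P.normExp_edge_le hp0 hp1 (by omega) hx hy hx1 hy1 (hr.trans hrs) (hH.mono hrs) hH0
    _ ≤ (1 + M) ^ 2 * Real.exp 2 * edgeRate p x y s * (Real.exp (M ^ 2 * 2) *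
        P.normExp S (m + Pi.single x 1 + Pi.single y 1) r H) := by
        gcongr
        exact P.normExp_le_of_le hp0 hp1 hM' hr hrs hH hH0
    _ = _ := by ring

/-- The constant in the bound on the probability that three given edges are created at
three given edge-steps. -/
noncomputable def edgeTripleConst : ℝ :=
  ((1 + (6 : ℕ)) ^ 2 * Real.exp 2 * Real.exp ((6 : ℕ) ^ 2 * 2)) ^ 3 *
    ((6 + 1).factorial : ℝ) ^ 3

lemma edgeTripleConst_pos : 0 < edgeTripleConst := by
  unfold edgeTripleConst
  positivity

lemma integral_edgeInd_le_of_lt (hp0 : 0 ≤ p) (hp1 : p ≤ 1) {S : Finset ℕ} (hS : S.card ≤ 3)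
    (hS1 : ∀ v ∈ S, 1 ≤ v) {x₁ y₁ x₂ y₂ x₃ y₃ : ℕ} (hx₁ : x₁ ∈ S) (hy₁ : y₁ ∈ S) (hx₂ : x₂ ∈ S)
    (hy₂ : y₂ ∈ S) (hx₃ : x₃ ∈ S) (hy₃ : y₃ ∈ S) {r₁ r₂ r₃ : ℕ} (h₁ : 1 ≤ r₁) (h₂ : r₁ < r₂)
    (h₃ : r₂ < r₃) :
    ∫ ω, P.edgeInd x₁ y₁ (r₁ + 1) ω * P.edgeInd x₂ y₂ (r₂ + 1) ω *
        P.edgeInd x₃ y₃ (r₃ + 1) ω ∂P.μ ≤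
      edgeTripleConst * (edgeRate p x₁ y₁ r₁ * edgeRate p x₂ y₂ r₂ * edgeRate p x₃ y₃ r₃) := by
  set K : ℝ := (1 + (6 : ℕ)) ^ 2 * Real.exp 2 * Real.exp ((6 : ℕ) ^ 2 * 2) with hK
  have hK0 : 0 < K := by positivity
  have hR₁ := edgeRate_nonneg p x₁ y₁ r₁
  have hR₂ := edgeRate_nonneg p x₂ y₂ r₂
  have hR₃ := edgeRate_nonneg p x₃ y₃ r₃
  let m₁ : ℕ → ℕ := 0 + Pi.single x₃ 1 + Pi.single y₃ 1
  let m₂ : ℕ → ℕ := m₁ + Pi.single x₂ 1 + Pi.single y₂ 1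
  let m₃ : ℕ → ℕ := m₂ + Pi.single x₁ 1 + Pi.single y₁ 1
  have hsum : ∀ (m : ℕ → ℕ) (x y : ℕ),
      ∑ v ∈ S, (m + Pi.single x 1 + Pi.single y 1 : ℕ → ℕ) v ≤ ∑ v ∈ S, m v + 2 := fun m x y =>
    (sum_add_single_le S _ y).trans (Nat.add_le_add_right (sum_add_single_le S m x) 1)
  have hm₁ : ∑ v ∈ S, m₁ v ≤ 2 := (hsum 0 x₃ y₃).trans (by simp)
  have hm₂ : ∑ v ∈ S, m₂ v ≤ 4 := (hsum m₁ x₂ y₂).trans (by omega)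
  have hm₃ : ∑ v ∈ S, m₃ v ≤ 6 := (hsum m₂ x₁ y₁).trans (by omega)
  let H₁ : P.Ω → ℝ := fun ω => 1 * P.edgeInd x₁ y₁ (r₁ + 1) ω
  let H₂ : P.Ω → ℝ := fun ω => H₁ ω * P.edgeInd x₂ y₂ (r₂ + 1) ω
  have hH₁ : P.BddMeas (r₁ + 1) H₁ := (bddMeas_const _ 1).mul (P.bddMeas_edgeInd _ _ _)
  have hH₂ : P.BddMeas (r₂ + 1) H₂ := (hH₁.mono (by omega)).mul (P.bddMeas_edgeInd _ _ _)
  have hH₁0 : ∀ ω, 0 ≤ H₁ ω := fun ω => mul_nonneg zero_le_one (P.edgeInd_nonneg _ _ _ ω)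
  have hH₂0 : ∀ ω, 0 ≤ H₂ ω := fun ω => mul_nonneg (hH₁0 ω) (P.edgeInd_nonneg _ _ _ ω)
  calc _ = P.normExp S 0 (r₃ + 1) (fun ω => H₂ ω * P.edgeInd x₃ y₃ (r₃ + 1) ω) := by
        simp [normExp, degProd, growthProd, H₂, H₁]
    _ ≤ K * edgeRate p x₃ y₃ r₃ * P.normExp S m₁ (r₂ + 1) H₂ :=
        P.normExp_edge_le_of_lt hp0 hp1 (by simp) hx₃ hy₃ (hS1 _ hx₃) (hS1 _ hy₃) (by omega)
          h₃ hH₂ hH₂0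
    _ ≤ K * edgeRate p x₃ y₃ r₃ * (K * edgeRate p x₂ y₂ r₂ *
          P.normExp S m₂ (r₁ + 1) H₁) := by
        gcongr
        exact P.normExp_edge_le_of_lt hp0 hp1 (by omega) hx₂ hy₂ (hS1 _ hx₂) (hS1 _ hy₂)
          (by omega) h₂ hH₁ hH₁0
    _ ≤ K * edgeRate p x₃ y₃ r₃ * (K * edgeRate p x₂ y₂ r₂ * (K * edgeRate p x₁ y₁ r₁ *
          P.normExp S m₃ 1 (fun _ => 1))) := by
        gcongr
        exact P.normExp_edge_le_of_lt hp0 hp1 (by omega) hx₁ hy₁ (hS1 _ hx₁) (hS1 _ hy₁)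
          le_rfl h₁ (bddMeas_const 1 1) fun _ => zero_le_one
    _ ≤ K * edgeRate p x₃ y₃ r₃ * (K * edgeRate p x₂ y₂ r₂ * (K * edgeRate p x₁ y₁ r₁ *
          ((6 + 1).factorial : ℝ) ^ 3)) := by
        gcongr
        refine (P.normExp_one_le hm₃).trans (pow_le_pow_right₀ ?_ hS)
        exact_mod_cast Nat.factorial_pos _
    _ = _ := by
        unfold edgeTripleConst
        rw [← hK]
        ring

lemma integral_edgeInd_le (hp0 : 0 ≤ p) (hp1 : p ≤ 1) {S : Finset ℕ} (hS : S.card ≤ 3)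
    (hS1 : ∀ v ∈ S, 1 ≤ v) {x₁ y₁ x₂ y₂ x₃ y₃ : ℕ} (hx₁ : x₁ ∈ S) (hy₁ : y₁ ∈ S) (hx₂ : x₂ ∈ S)
    (hy₂ : y₂ ∈ S) (hx₃ : x₃ ∈ S) (hy₃ : y₃ ∈ S) {r₁ r₂ r₃ : ℕ} (h₁ : 1 ≤ r₁) (h₂ : 1 ≤ r₂)
    (h₃ : 1 ≤ r₃) (h₁₂ : r₁ ≠ r₂) (h₁₃ : r₁ ≠ r₃) (h₂₃ : r₂ ≠ r₃) :
    ∫ ω, P.edgeInd x₁ y₁ (r₁ + 1) ω * P.edgeInd x₂ y₂ (r₂ + 1) ω *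
        P.edgeInd x₃ y₃ (r₃ + 1) ω ∂P.μ ≤
      edgeTripleConst * (edgeRate p x₁ y₁ r₁ * edgeRate p x₂ y₂ r₂ * edgeRate p x₃ y₃ r₃) := by
  rcases lt_or_gt_of_ne h₁₂ with h | h <;> rcases lt_or_gt_of_ne h₁₃ with h' | h' <;>
    rcases lt_or_gt_of_ne h₂₃ with h'' | h''
  · exact P.integral_edgeInd_le_of_lt hp0 hp1 hS hS1 hx₁ hy₁ hx₂ hy₂ hx₃ hy₃ h₁ h h''
  · simpa only [mul_comm, mul_left_comm, mul_assoc] using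
      P.integral_edgeInd_le_of_lt hp0 hp1 hS hS1 hx₁ hy₁ hx₃ hy₃ hx₂ hy₂ h₁ h' h''
  · omega
  · simpa only [mul_comm, mul_left_comm, mul_assoc] using
      P.integral_edgeInd_le_of_lt hp0 hp1 hS hS1 hx₃ hy₃ hx₁ hy₁ hx₂ hy₂ h₃ h' h
  · simpa only [mul_comm, mul_left_comm, mul_assoc] using
      P.integral_edgeInd_le_of_lt hp0 hp1 hS hS1 hx₂ hy₂ hx₁ hy₁ hx₃ hy₃ h₂ h h'
  · omega
  · simpa only [mul_comm, mul_left_comm, mul_assoc] using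
      P.integral_edgeInd_le_of_lt hp0 hp1 hS hS1 hx₂ hy₂ hx₃ hy₃ hx₁ hy₁ h₂ h'' h'
  · simpa only [mul_comm, mul_left_comm, mul_assoc] using
      P.integral_edgeInd_le_of_lt hp0 hp1 hS hS1 hx₃ hy₃ hx₂ hy₂ hx₁ hy₁ h₃ h'' h

/-- Triples of distinct times smaller than `t`. -/
noncomputable def distinctTimes (t : ℕ) : Finset (ℕ × ℕ × ℕ) :=
  (Finset.Ico 1 t ×ˢ Finset.Ico 1 t ×ˢ Finset.Ico 1 t).filter
    fun r => r.1 ≠ r.2.1 ∧ r.1 ≠ r.2.2 ∧ r.2.1 ≠ r.2.2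

/-- Number of triples of edge-steps up to time `t` joining the three pairs of vertices from
`{i, j, k}`. -/
noncomputable def triangleCount (t i j k : ℕ) (ω : P.Ω) : ℝ :=
  ∑ r ∈ distinctTimes t, P.edgeInd i j (r.1 + 1) ω * P.edgeInd i k (r.2.1 + 1) ω *
    P.edgeInd j k (r.2.2 + 1) ω

lemma triangleCount_nonneg (t i j k : ℕ) (ω : P.Ω) : 0 ≤ P.triangleCount t i j k ω :=
  Finset.sum_nonneg fun _ _ => mul_nonneg (mul_nonneg (P.edgeInd_nonneg _ _ _ ω)
    (P.edgeInd_nonneg _ _ _ ω)) (P.edgeInd_nonneg _ _ _ ω)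

lemma EdgeJoined.exists_edgeInd {P : PAProcess p} {t i j : ℕ} {ω : P.Ω}
    (h : P.EdgeJoined t i j ω) :
    ∃ r ∈ Finset.Ico 1 t, P.edgeInd i j (r + 1) ω = 1 ∧
      (P.ep (r + 1) ω = (i, j) ∨ P.ep (r + 1) ω = (j, i)) := by
  obtain ⟨s, hs, hs2, hZ, he⟩ := h
  obtain ⟨r, rfl⟩ : ∃ r, s = r + 1 := ⟨s - 1, by omega⟩
  exact ⟨r, by simp at hs ⊢; omega, by simp [edgeInd, hZ, he], he⟩

lemma one_le_triangleCount {t i j k : ℕ} (hij : i < j) (hjk : j < k) {ω : P.Ω}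
    (h₁ : P.EdgeJoined t i j ω) (h₂ : P.EdgeJoined t i k ω) (h₃ : P.EdgeJoined t j k ω) :
    1 ≤ P.triangleCount t i j k ω := by
  obtain ⟨r₁, hr₁, e₁, f₁⟩ := h₁.exists_edgeInd
  obtain ⟨r₂, hr₂, e₂, f₂⟩ := h₂.exists_edgeInd
  obtain ⟨r₃, hr₃, e₃, f₃⟩ := h₃.exists_edgeInd
  have hmem : (r₁, r₂, r₃) ∈ distinctTimes t := by
    simp only [distinctTimes, Finset.mem_filter, Finset.mem_product]
    refine ⟨⟨hr₁, hr₂, hr₃⟩, ?_, ?_, ?_⟩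
    · rintro rfl
      rcases f₁ with h | h <;> rw [h] at f₂ <;> simp at f₂ <;> omega
    · rintro rfl
      rcases f₁ with h | h <;> rw [h] at f₃ <;> simp at f₃ <;> omega
    · rintro rfl
      rcases f₂ with h | h <;> rw [h] at f₃ <;> simp at f₃ <;> omega
  refine le_trans (by simp [e₁, e₂, e₃]) (Finset.single_le_sum (fun _ _ => mul_nonneg
    (mul_nonneg (P.edgeInd_nonneg _ _ _ ω) (P.edgeInd_nonneg _ _ _ ω))
    (P.edgeInd_nonneg _ _ _ ω)) hmem)

lemma integrable_edgeInd_mul (i j k r₁ r₂ r₃ : ℕ) :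
    Integrable (fun ω => P.edgeInd i j r₁ ω * P.edgeInd i k r₂ ω * P.edgeInd j k r₃ ω) P.μ :=
  ((((P.bddMeas_edgeInd i j r₁).mono (by omega : r₁ ≤ r₁ + r₂ + r₃)).mul
    ((P.bddMeas_edgeInd i k r₂).mono (by omega))).mul
    ((P.bddMeas_edgeInd j k r₃).mono (by omega))).integrable

lemma integrable_triangleCount (t i j k : ℕ) : Integrable (P.triangleCount t i j k) P.μ :=
  integrable_finsetSum _ fun _ _ => P.integrable_edgeInd_mul _ _ _ _ _ _

lemma sum_rpow_neg_le (hp0 : 0 ≤ p) (hp1 : p < 1) {t : ℕ} (ht : 1 ≤ t) :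
    ∑ r ∈ Finset.Ico 1 t, (r : ℝ) ^ (-p) ≤ (t : ℝ) ^ (1 - p) / (1 - p) := by
  have key : ∀ n : ℕ, ∑ r ∈ Finset.Ico 1 (n + 1), (r : ℝ) ^ (-p) ≤
      (n : ℝ) ^ (1 - p) / (1 - p) := by
    intro n
    induction n with
    | zero => simp [Real.zero_rpow (by linarith : 1 - p ≠ 0)]
    | succ n ih =>
      have hn : (0 : ℝ) < n + 1 := by positivity
      have hq : 0 < 1 - p := by linarith
      rw [Finset.sum_Ico_succ_top (by omega)]
      rw [le_div_iff₀ hq] at ih ⊢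
      have h1 := rpow_one_add_le_one_add_mul_self (s := -1 / ((n : ℝ) + 1)) (p := 1 - p)
        (by rw [le_div_iff₀ hn]; linarith) hq.le (by linarith)
      have h2 : 1 + -1 / ((n : ℝ) + 1) = n / (n + 1) := by field_simp; ring
      have h3 : ((n : ℝ) + 1) ^ (1 - p) = (n + 1) * ((n : ℝ) + 1) ^ (-p) := by
        rw [sub_eq_add_neg, Real.rpow_add hn, Real.rpow_one]
      have h4 : (0 : ℝ) < ((n : ℝ) + 1) ^ (-p) := Real.rpow_pos_of_pos hn _
      rw [h2, Real.div_rpow (by positivity) hn.le, div_le_iff₀ (by positivity), h3] at h1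
      have h5 : (1 + (1 - p) * (-1 / ((n : ℝ) + 1))) * ((n + 1) * ((n : ℝ) + 1) ^ (-p)) =
          (n + 1) * ((n : ℝ) + 1) ^ (-p) - (1 - p) * ((n : ℝ) + 1) ^ (-p) := by
        field_simp
        ring
      push_cast
      rw [h3]
      linarith
  have h := key (t - 1)
  rw [Nat.sub_add_cancel ht] at h
  refine h.trans ?_
  have : 0 < 1 - p := by linarith
  gcongr
  omega

lemma integral_triangleCount_le (hp0 : 0 ≤ p) (hp1 : p < 1) {t i j k : ℕ} (ht : 1 ≤ t)
    (hi : 1 ≤ i) (hj : 1 ≤ j) (hk : 1 ≤ k) :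
    ∫ ω, P.triangleCount t i j k ω ∂P.μ ≤
      edgeTripleConst * ((t : ℝ) ^ (1 - p) / (1 - p)) ^ 3 * ((i : ℝ) * j * k) ^ (-(2 - p)) := by
  have hS1 : ∀ v ∈ ({i, j, k} : Finset ℕ), 1 ≤ v := by simp [hi, hj, hk]
  have hi' : (0 : ℝ) < i := by exact_mod_cast hi
  have hj' : (0 : ℝ) < j := by exact_mod_cast hj
  have hk' : (0 : ℝ) < k := by exact_mod_cast hk
  have hC := edgeTripleConst_pos
  unfold triangleCount
  rw [integral_finsetSum _ fun _ _ => P.integrable_edgeInd_mul _ _ _ _ _ _]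
  calc _ ≤ ∑ r ∈ distinctTimes t, edgeTripleConst *
          (edgeRate p i j r.1 * edgeRate p i k r.2.1 * edgeRate p j k r.2.2) := by
        refine Finset.sum_le_sum fun r hr => ?_
        simp only [distinctTimes, Finset.mem_filter, Finset.mem_product, Finset.mem_Ico] at hr
        exact P.integral_edgeInd_le hp0 hp1.le Finset.card_le_three hS1 (by simp) (by simp)
          (by simp) (by simp) (by simp) (by simp) hr.1.1.1 hr.1.2.1.1 hr.1.2.2.1 hr.2.1
          hr.2.2.1 hr.2.2.2
    _ ≤ ∑ r ∈ Finset.Ico 1 t ×ˢ Finset.Ico 1 t ×ˢ Finset.Ico 1 t, edgeTripleConst *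
          (edgeRate p i j r.1 * edgeRate p i k r.2.1 * edgeRate p j k r.2.2) :=
        Finset.sum_le_sum_of_subset_of_nonneg (Finset.filter_subset _ _) fun r _ _ =>
          mul_nonneg hC.le (mul_nonneg (mul_nonneg (edgeRate_nonneg _ _ _ _)
            (edgeRate_nonneg _ _ _ _)) (edgeRate_nonneg _ _ _ _))
    _ = edgeTripleConst * (∑ r ∈ Finset.Ico 1 t, (r : ℝ) ^ (-p)) ^ 3 *
          ((i : ℝ) * j * k) ^ (-(2 - p)) := by
        have h : ((i : ℝ) * j * k) ^ (-(2 - p)) = ((i : ℝ) * j) ^ (-(1 - p / 2)) *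
            ((i : ℝ) * k) ^ (-(1 - p / 2)) * ((j : ℝ) * k) ^ (-(1 - p / 2)) := by
          rw [← Real.mul_rpow (by positivity) (by positivity),
            ← Real.mul_rpow (by positivity) (by positivity),
            show (i : ℝ) * j * (i * k) * (j * k) = (i * j * k) ^ (2 : ℝ) by
              rw [Real.rpow_two]; ring,
            ← Real.rpow_mul (by positivity)]
          congr 1
          ring
        simp only [Finset.sum_product, edgeRate, ← Finset.mul_sum, ← Finset.sum_mul]
        rw [h]
        ring
    _ ≤ _ := by
        have := sum_rpow_neg_le hp0 hp1 ht
        gcongr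

lemma sum_inv_mul_le (t : ℕ) :
    ∑ q ∈ Finset.Icc 1 t ×ˢ Finset.Icc 1 t ×ˢ Finset.Icc 1 t, ((q.1 : ℝ) * q.2.1 * q.2.2)⁻¹ ≤
      (1 + Real.log t) ^ 3 := by
  have h : ∑ i ∈ Finset.Icc 1 t, (i : ℝ)⁻¹ ≤ 1 + Real.log t := by
    have := harmonic_le_one_add_log t
    rw [harmonic_eq_sum_Icc] at this
    push_cast at this
    exact this
  calc _ = (∑ i ∈ Finset.Icc 1 t, (i : ℝ)⁻¹) ^ 3 := by
        simp only [Finset.sum_product, mul_inv, ← Finset.mul_sum, ← Finset.sum_mul]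
        ring
    _ ≤ _ := by
        have : 0 ≤ ∑ i ∈ Finset.Icc 1 t, (i : ℝ)⁻¹ := Finset.sum_nonneg fun _ _ => by positivity
        gcongr

lemma one_add_log_pow_le {t : ℕ} (ht : 2 ≤ t) :
    (1 + Real.log t) ^ 3 ≤ 864 * Real.log t ^ 8 := by
  have h1 : 1 ≤ 2 * Real.log t := by
    have h2 : Real.log 2 ≤ Real.log t := Real.log_le_log (by norm_num) (by exact_mod_cast ht)
    have := Real.log_two_gt_d9
    linarith
  have h0 : 0 ≤ Real.log t := by linarith
  calc (1 + Real.log t) ^ 3 ≤ (3 * Real.log t) ^ 3 * 1 := by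
        rw [mul_one]
        gcongr
        linarith
    _ ≤ (3 * Real.log t) ^ 3 * (2 * Real.log t) ^ 5 := by
        gcongr
        exact one_le_pow₀ h1
    _ = _ := by ring

/-- The triples `i < j < k` of vertices up to `t` with `i * j * k ≥ t ^ (3 * α)`. -/
noncomputable def largeTriples (p : ℝ) (t : ℕ) : Finset (ℕ × ℕ × ℕ) :=
  (Finset.Icc 1 t ×ˢ Finset.Icc 1 t ×ˢ Finset.Icc 1 t).filter fun q =>
    q.1 < q.2.1 ∧ q.2.1 < q.2.2 ∧
      (t : ℝ) ^ (3 * ((1 - p) / (2 - p))) ≤ ((q.1 * q.2.1 * q.2.2 : ℕ) : ℝ)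

lemma sum_largeTriples_le (hp1 : p ≤ 1) {t : ℕ} (ht : 1 ≤ t) :
    ∑ q ∈ largeTriples p t, ((q.1 : ℝ) * q.2.1 * q.2.2) ^ (-(2 - p)) ≤
      ((t : ℝ) ^ (3 * ((1 - p) / (2 - p)))) ^ (-(1 - p)) * (1 + Real.log t) ^ 3 := by
  have ht' : (0 : ℝ) < t := by exact_mod_cast ht
  have hT : 0 < (t : ℝ) ^ (3 * ((1 - p) / (2 - p))) := Real.rpow_pos_of_pos ht' _
  calc _ ≤ ∑ q ∈ largeTriples p t, ((t : ℝ) ^ (3 * ((1 - p) / (2 - p)))) ^ (-(1 - p)) *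
          ((q.1 : ℝ) * q.2.1 * q.2.2)⁻¹ := by
        refine Finset.sum_le_sum fun q hq => ?_
        have hq' := (Finset.mem_filter.1 hq).2.2.2
        push_cast at hq'
        have hpos := hT.trans_le hq'
        rw [show -(2 - p) = -(1 - p) + -1 by ring, Real.rpow_add hpos, Real.rpow_neg_one]
        exact mul_le_mul_of_nonneg_right
          (Real.rpow_le_rpow_of_nonpos hT hq' (by linarith)) (by positivity)
    _ ≤ ((t : ℝ) ^ (3 * ((1 - p) / (2 - p)))) ^ (-(1 - p)) *
          ∑ q ∈ Finset.Icc 1 t ×ˢ Finset.Icc 1 t ×ˢ Finset.Icc 1 t,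
            ((q.1 : ℝ) * q.2.1 * q.2.2)⁻¹ := by
        rw [← Finset.mul_sum]
        gcongr
        exact Finset.filter_subset _ _
    _ ≤ _ := by
        gcongr
        exact sum_inv_mul_le t

lemma rpow_largeTriples (hp1 : p < 1) {t : ℕ} (ht : 1 ≤ t) :
    ((t : ℝ) ^ (1 - p)) ^ 3 * ((t : ℝ) ^ (3 * ((1 - p) / (2 - p)))) ^ (-(1 - p)) =
      (t : ℝ) ^ (3 * ((1 - p) / (2 - p))) := by
  have ht' : (0 : ℝ) < t := by exact_mod_cast ht
  have h : 2 - p ≠ 0 := by linarith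
  rw [← Real.rpow_natCast, ← Real.rpow_mul ht'.le, ← Real.rpow_mul ht'.le,
    ← Real.rpow_add ht']
  congr 1
  push_cast
  field_simp
  ring

lemma card_le_sum_triangleCount {t : ℕ} {ω : P.Ω} {D : Finset (ℕ × ℕ × ℕ)}
    (hD : ∀ q ∈ D, q ∈ largeTriples p t ∧ P.EdgeJoined t q.1 q.2.1 ω ∧
      P.EdgeJoined t q.1 q.2.2 ω ∧ P.EdgeJoined t q.2.1 q.2.2 ω) :
    (D.card : ℝ) ≤ ∑ q ∈ largeTriples p t, P.triangleCount t q.1 q.2.1 q.2.2 ω := by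
  calc (D.card : ℝ) = ∑ q ∈ D, (1 : ℝ) := by simp
    _ ≤ ∑ q ∈ D, P.triangleCount t q.1 q.2.1 q.2.2 ω := by
        refine Finset.sum_le_sum fun q hq => ?_
        obtain ⟨h, h₁, h₂, h₃⟩ := hD q hq
        rw [largeTriples, Finset.mem_filter] at h
        exact P.one_le_triangleCount h.2.1 h.2.2.1 h₁ h₂ h₃
    _ ≤ _ := Finset.sum_le_sum_of_subset_of_nonneg (fun q hq => (hD q hq).1)
        fun _ _ _ => P.triangleCount_nonneg _ _ _ _ ω

lemma integral_card_le (hp0 : 0 ≤ p) (hp1 : p < 1) {t : ℕ} (ht : 2 ≤ t) :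
    ∫ ω, ((((Finset.Icc 1 t ×ˢ Finset.Icc 1 t ×ˢ Finset.Icc 1 t).filter
        (fun q => q.1 < q.2.1 ∧ q.2.1 < q.2.2 ∧
          (t : ℝ) ^ (3 * ((1 - p) / (2 - p))) ≤ ((q.1 * q.2.1 * q.2.2 : ℕ) : ℝ) ∧
          P.EdgeJoined t q.1 q.2.1 ω ∧ P.EdgeJoined t q.1 q.2.2 ω ∧
          P.EdgeJoined t q.2.1 q.2.2 ω)).card : ℕ) : ℝ) ∂P.μ ≤
      864 * edgeTripleConst / (1 - p) ^ 3 * (t : ℝ) ^ (3 * ((1 - p) / (2 - p))) *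
        Real.log t ^ 8 := by
  have hC := edgeTripleConst_pos
  have hq : 0 < 1 - p := by linarith
  have ht' : (0 : ℝ) < t := by exact_mod_cast (by omega : 0 < t)
  calc _ ≤ ∫ ω, ∑ q ∈ largeTriples p t, P.triangleCount t q.1 q.2.1 q.2.2 ω ∂P.μ := by
        refine integral_mono_of_nonneg (.of_forall fun _ => Nat.cast_nonneg _)
          (integrable_finsetSum _ fun _ _ => P.integrable_triangleCount _ _ _ _)
          (.of_forall fun ω => P.card_le_sum_triangleCount fun q hq => ?_)
        rw [Finset.mem_filter] at hq
        obtain ⟨h, h₁, h₂, h₃, h₄⟩ := hq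
        rw [largeTriples, Finset.mem_filter]
        exact ⟨⟨h, h₁, h₂, h₃⟩, h₄⟩
    _ = ∑ q ∈ largeTriples p t, ∫ ω, P.triangleCount t q.1 q.2.1 q.2.2 ω ∂P.μ :=
        integral_finsetSum _ fun _ _ => P.integrable_triangleCount _ _ _ _
    _ ≤ ∑ q ∈ largeTriples p t, edgeTripleConst * ((t : ℝ) ^ (1 - p) / (1 - p)) ^ 3 *
          ((q.1 : ℝ) * q.2.1 * q.2.2) ^ (-(2 - p)) := by
        refine Finset.sum_le_sum fun q hq => ?_
        have h := (Finset.mem_filter.1 hq).1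
        simp only [Finset.mem_product, Finset.mem_Icc] at h
        exact P.integral_triangleCount_le hp0 hp1 (by omega) h.1.1 h.2.1.1 h.2.2.1
    _ ≤ edgeTripleConst * ((t : ℝ) ^ (1 - p) / (1 - p)) ^ 3 *
          (((t : ℝ) ^ (3 * ((1 - p) / (2 - p)))) ^ (-(1 - p)) *
            (864 * Real.log t ^ 8)) := by
        rw [← Finset.mul_sum]
        gcongr
        exact (sum_largeTriples_le hp1.le (by omega)).trans
          (mul_le_mul_of_nonneg_left (one_add_log_pow_le ht) (by positivity))
    _ = 864 * edgeTripleConst / (1 - p) ^ 3 * (((t : ℝ) ^ (1 - p)) ^ 3 *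
          ((t : ℝ) ^ (3 * ((1 - p) / (2 - p)))) ^ (-(1 - p))) * Real.log t ^ 8 := by
        rw [div_pow]
        ring
    _ = _ := by rw [rpow_largeTriples hp1 (by omega)]

end Bounds

end PAProcess

/-- For `p ∈ (0,1)` and `α = (1-p)/(2-p)`, let `𝒯₂⁰(G_t)` be the number of triples
`i < j < k` with `i·j·k ≥ t^{3α}` such that each of the pairs `{i,j}`, `{i,k}`, `{j,k}` is
joined in `G_t` by at least one edge created at an edge-step.  Then there is `C > 0`
(depending only on `p`) such that `E[𝒯₂⁰(G_t)] ≤ C t^{3α} (log t)⁸` for all `t ≥ 2`. -/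
theorem expected_T20_bound (p : ℝ) (hp0 : 0 < p) (hp1 : p < 1)
    (P : PAProcess p) :
    ∃ C : ℝ, 0 < C ∧
      ∀ t : ℕ, 2 ≤ t →
        ∫ ω, ((((Finset.Icc 1 t ×ˢ Finset.Icc 1 t ×ˢ Finset.Icc 1 t).filter
            (fun q => q.1 < q.2.1 ∧ q.2.1 < q.2.2 ∧
              (t : ℝ) ^ (3 * ((1 - p) / (2 - p))) ≤ ((q.1 * q.2.1 * q.2.2 : ℕ) : ℝ) ∧
              P.EdgeJoined t q.1 q.2.1 ω ∧ P.EdgeJoined t q.1 q.2.2 ω ∧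
              P.EdgeJoined t q.2.1 q.2.2 ω)).card : ℕ) : ℝ) ∂P.μ ≤
          C * (t : ℝ) ^ (3 * ((1 - p) / (2 - p))) * Real.log t ^ 8 := by
  have h : 0 < 1 - p := by linarith
  have hC := PAProcess.edgeTripleConst_pos
  exact ⟨864 * PAProcess.edgeTripleConst / (1 - p) ^ 3, by positivity,
    fun t ht => P.integral_card_le hp0.le hp1 ht⟩
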